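/- Assume in addition that φ is not Lebesgue-almost-everywhere equal to 0, so that μ ↦ μ/Ψ(μ) attains its maximum on (0,∞) at some point μ*. Then the radius of convergence of the virial series ρ ↦ Σ_{n≥1} (β_n/n!) ρ^n is at least sup_{0<μ≤μ*} μ/(2·Ψ(μ) − 1). -/

import Mathlib

open MeasureTheory ENNReal
open scoped Classical

noncomputable section

/-- Pair weight `w(x,y) = exp(-β φ(x-y))`, with `exp(-(+∞)) = 0`. -/
def pairW {d : ℕ} (β : ℝ) (φ : (Fin d → ℝ) → ℝ≥0∞) (x y : Fin d → ℝ) : ℝ :=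
  if φ (x - y) = ∞ then 0 else Real.exp (-(β * (φ (x - y)).toReal))

/-- Truncated weight `ω^T_n`: sum over connected graphs on `{1,…,n}`. -/
def omegaT {S : Type*} (w : S → S → ℝ) (n : ℕ) (x : Fin n → S) : ℝ :=
  ∑ G : SimpleGraph (Fin n),
    if G.Connected then
      ∏ p ∈ Finset.univ.filter (fun p : Fin n × Fin n => p.1 < p.2 ∧ G.Adj p.1 p.2),
        (w (x p.1) (x p.2) - 1)
    else 0

/-- `φ_n(x; x_1,…,x_n) = Π_i (1 - w(x,x_i)) Π_{i<j} w(x_i,x_j)`. -/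
def phiVertex {S : Type*} (w : S → S → ℝ) (n : ℕ) (x : S) (y : Fin n → S) : ℝ :=
  (∏ i, (1 - w x (y i))) *
    ∏ p ∈ Finset.univ.filter (fun p : Fin n × Fin n => p.1 < p.2), w (y p.1) (y p.2)

/-- `g(n) = ∫_{ℝ^{dn}} φ_n(0; x_1,…,x_n) dx`. -/
def gCoef {d : ℕ} (β : ℝ) (φ : (Fin d → ℝ) → ℝ≥0∞) (n : ℕ) : ℝ≥0∞ :=
  ∫⁻ y : Fin n → Fin d → ℝ, ENNReal.ofReal (phiVertex (pairW β φ) n 0 y)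

/-- The vertex sum `Ψ(t) = 1 + Σ_{n≥1} g(n) t^n/n!` (extended to `t ∈ [0,∞]`). -/
def vertexSum {d : ℕ} (β : ℝ) (φ : (Fin d → ℝ) → ℝ≥0∞) (t : ℝ≥0∞) : ℝ≥0∞ :=
  1 + ∑' n : ℕ, gCoef β φ (n + 1) * t ^ (n + 1) / ((n + 1).factorial : ℝ≥0∞)

/-- The children of vertex `i` in a tree on `{0,…,n}` rooted at `0`. -/
def childrenF {n : ℕ} (τ : SimpleGraph (Fin (n + 1))) (i : Fin (n + 1)) :
    Finset (Fin (n + 1)) :=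
  Finset.univ.filter (fun j => τ.Adj i j ∧ τ.dist 0 j = τ.dist 0 i + 1)

/-- `φ_{|t|}(x; (y_j)_{j∈t})`, the vertex weight of `x` with the family of children `t`. -/
def phiFinset {S : Type*} {n : ℕ} (w : S → S → ℝ) (x : S)
    (t : Finset (Fin n)) (y : Fin n → S) : ℝ :=
  (∏ j ∈ t, (1 - w x (y j))) *
    ∏ p ∈ (t ×ˢ t).filter (fun p => p.1 < p.2), w (y p.1) (y p.2)

/-- `B_n(x_0; x_1,…,x_n)`: sum over trees rooted at `0` of the product of vertex weights. -/
def treeB {S : Type*} (w : S → S → ℝ) (n : ℕ) (x : Fin (n + 1) → S) : ℝ :=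
  ∑ τ : SimpleGraph (Fin (n + 1)),
    if τ.IsTree then ∏ i : Fin (n + 1), phiFinset w (x i) (childrenF τ i) x else 0

/-- The tree sum `𝓑(r) = 1 + Σ_{n≥1} (r^n/n!) ∫ B_n(0;x_1,…,x_n) dx`. -/
def treeSum {d : ℕ} (β : ℝ) (φ : (Fin d → ℝ) → ℝ≥0∞) (r : ℝ) : ℝ≥0∞ :=
  1 + ∑' n : ℕ, ENNReal.ofReal (r ^ (n + 1) / (n + 1).factorial) *
    ∫⁻ y : Fin (n + 1) → Fin d → ℝ,
      ENNReal.ofReal (treeB (pairW β φ) (n + 1) (Fin.cons 0 y))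

/-- `bCoef n` represents the infinite-volume cluster coefficient `b_{n+1}`. -/
def bCoef {d : ℕ} (β : ℝ) (φ : (Fin d → ℝ) → ℝ≥0∞) (n : ℕ) : ℝ :=
  ∫ y : Fin n → Fin d → ℝ, omegaT (pairW β φ) (n + 1) (Fin.cons 0 y)

/-- Generalized binomial coefficient `binom(x,k) = x(x-1)⋯(x-k+1)/k!`. -/
def genBinom (x : ℝ) (k : ℕ) : ℝ :=
  (∏ i ∈ Finset.range k, (x - i)) / k.factorial

/-- Partial exponential Bell polynomial `B_{n,k}(y_1,…,y_{n-k+1})`. -/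
def BellPoly (n k : ℕ) (y : ℕ → ℝ) : ℝ :=
  ∑ α ∈ (Fintype.piFinset fun _ : Fin (n - k + 1) => Finset.range (n + 1)) |>.filter
      (fun α : Fin (n - k + 1) → ℕ =>
        (∑ i, α i) = k ∧ (∑ i : Fin (n - k + 1), (i.1 + 1) * α i) = n),
    (n.factorial : ℝ) / (∏ i, ((α i).factorial : ℝ)) *
      ∏ i : Fin (n - k + 1), (y (i.1 + 1) / ((i.1 + 1).factorial : ℝ)) ^ (α i)

/-- `vCoef n` represents the virial coefficient `β_{n+1}` (so `vCoef 0 = β_1 = 1`). -/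
def vCoef {d : ℕ} (β : ℝ) (φ : (Fin d → ℝ) → ℝ≥0∞) (n : ℕ) : ℝ :=
  if n = 0 then 1 else
    ∑ k ∈ Finset.Icc 1 n,
      genBinom (-(n : ℝ)) k * (k.factorial : ℝ) * BellPoly n k (fun j => bCoef β φ j)

/-- The non-diagonal unordered pairs of elements of `A`. -/
def pairsOf {V : Type*} [DecidableEq V] (A : Finset V) : Finset (Sym2 V) :=
  A.sym2.filter fun e => ¬ e.IsDiag

/-- The Boltzmann factor of a finite configuration. -/
def psi {V : Type*} [DecidableEq V] (W : Sym2 V → ℝ) (A : Finset V) : ℝ :=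
  ∏ e ∈ pairsOf A, W e

section Combinatorics

variable {V : Type*} [DecidableEq V]

lemma mk_mem_pairsOf {A : Finset V} {x y : V} :
    s(x, y) ∈ pairsOf A ↔ x ∈ A ∧ y ∈ A ∧ x ≠ y := by
  simp [pairsOf, and_assoc]

@[simp] lemma psi_empty (W : Sym2 V → ℝ) : psi W ∅ = 1 := by simp [psi, pairsOf]

lemma pairsOf_insert {a : V} {A : Finset V} (ha : a ∉ A) :
    pairsOf (insert a A) = A.image (fun b => s(a, b)) ∪ pairsOf A := by
  ext e
  induction e using Sym2.ind with
  | _ x y =>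
    simp only [mk_mem_pairsOf, Finset.mem_insert, Finset.mem_union, Finset.mem_image,
      Sym2.eq_iff]
    grind

lemma psi_insert (W : Sym2 V → ℝ) {a : V} {A : Finset V} (ha : a ∉ A) :
    psi W (insert a A) = (∏ b ∈ A, W s(a, b)) * psi W A := by
  rw [psi, pairsOf_insert ha, Finset.prod_union, Finset.prod_image, psi]
  · intro x _ y _ h
    exact Sym2.congr_right.1 h
  · rw [Finset.disjoint_left]
    intro e he he'
    obtain ⟨b, -, rfl⟩ := Finset.mem_image.1 he
    exact ha (mk_mem_pairsOf.1 he').1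

lemma psi_split (W : Sym2 V → ℝ) {S X : Finset V} (h : S ⊆ X) :
    psi W X = psi W S * psi W (X \ S) * ∏ x ∈ X \ S, ∏ s ∈ S, W s(s, x) := by
  induction S using Finset.induction_on generalizing X with
  | empty => simp
  | insert a S ha ih =>
    have haX : a ∈ X := h (Finset.mem_insert_self _ _)
    have hS : S ⊆ X.erase a := fun x hx =>
      Finset.mem_erase.2 ⟨fun e => ha (e ▸ hx), h (Finset.mem_insert_of_mem hx)⟩
    have e1 : X \ insert a S = X.erase a \ S := by
      ext x; simp only [Finset.mem_sdiff, Finset.mem_insert, Finset.mem_erase]; tauto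
    conv_lhs => rw [← Finset.insert_erase haX, psi_insert W (Finset.notMem_erase a X), ih hS]
    rw [psi_insert W ha, e1, ← Finset.prod_sdiff hS]
    simp_rw [Finset.prod_insert ha, Finset.prod_mul_distrib]
    ring

/-- Swapping a sum over pairs of disjoint subsets. -/
lemma sum_disjoint_pairs_comm {M : Type*} [AddCommMonoid M] (X : Finset V)
    (g : Finset V → Finset V → Finset V → M) :
    ∑ S ∈ X.powerset, ∑ T ∈ (X \ S).powerset, g S T ((X \ S) \ T) =
      ∑ T ∈ X.powerset, ∑ S ∈ (X \ T).powerset, g S T ((X \ T) \ S) := by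
  have h : ∀ S T : Finset V, (X \ S) \ T = (X \ T) \ S := fun S T => by
    ext x; simp only [Finset.mem_sdiff]; tauto
  rw [Finset.sum_comm' (t' := X.powerset) (s' := fun T => (X \ T).powerset)]
  · exact Finset.sum_congr rfl fun T _ => Finset.sum_congr rfl fun S _ => by rw [h]
  intro S T
  simp only [Finset.mem_powerset, Finset.subset_sdiff]
  constructor
  · rintro ⟨a, b, c⟩; exact ⟨⟨a, c.symm⟩, b⟩
  · rintro ⟨⟨a, c⟩, b⟩; exact ⟨a, b, c.symm⟩

/-- Summing over chains `S ⊆ T ⊆ X` through the disjoint pair `S`, `T \ S`. -/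
lemma sum_chain_eq {M : Type*} [AddCommMonoid M] (X : Finset V)
    (g : Finset V → Finset V → Finset V → M) :
    ∑ T ∈ X.powerset, ∑ S ∈ T.powerset, g S (T \ S) (X \ T) =
      ∑ S ∈ X.powerset, ∑ T ∈ (X \ S).powerset, g S T ((X \ S) \ T) := by
  rw [Finset.sum_sigma', Finset.sum_sigma']
  refine Finset.sum_bij' (fun p _ => ⟨p.2, p.1 \ p.2⟩) (fun p _ => ⟨p.1 ∪ p.2, p.1⟩) ?_ ?_ ?_ ?_ ?_
  · rintro ⟨T, S⟩ h
    simp only [Finset.mem_sigma, Finset.mem_powerset] at h ⊢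
    exact ⟨h.2.trans h.1, Finset.sdiff_subset_sdiff h.1 le_rfl⟩
  · rintro ⟨S, T⟩ h
    simp only [Finset.mem_sigma, Finset.mem_powerset] at h ⊢
    exact ⟨Finset.union_subset h.1 (h.2.trans Finset.sdiff_subset), Finset.subset_union_left⟩
  · rintro ⟨T, S⟩ h
    simp only [Finset.mem_sigma, Finset.mem_powerset] at h
    simp [h.2]
  · rintro ⟨S, T⟩ h
    simp only [Finset.mem_sigma, Finset.mem_powerset, Finset.subset_sdiff] at h
    simp [Finset.union_sdiff_cancel_left h.2.2.symm]
  · rintro ⟨T, S⟩ h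
    simp only [Finset.mem_sigma, Finset.mem_powerset] at h
    congr 1
    ext x; simp only [Finset.mem_sdiff]
    have := @h.2 x
    tauto

/-- The interaction of the points of the list `L` with `x`. -/
def listW (W : Sym2 V → ℝ) (L : List V) (x : V) : ℝ := (L.map fun l => W s(l, x)).prod

omit [DecidableEq V] in
@[simp] lemma listW_nil (W : Sym2 V → ℝ) (x : V) : listW W [] x = 1 := rfl

omit [DecidableEq V] in
@[simp] lemma listW_cons (W : Sym2 V → ℝ) (y : V) (L : List V) (x : V) :
    listW W (y :: L) x = W s(y, x) * listW W L x := by simp [listW]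

omit [DecidableEq V] in
lemma listW_append (W : Sym2 V → ℝ) (L L' : List V) (x : V) :
    listW W (L ++ L') x = listW W L x * listW W L' x := by simp [listW]

omit [DecidableEq V] in
lemma listW_toList (W : Sym2 V → ℝ) (S : Finset V) (x : V) :
    listW W S.toList x = ∏ s ∈ S, W s(s, x) := by
  rw [listW, Finset.prod_map_toList]

/-- The vertex weight of `y` with the children `S`. -/
def vertexW (W : Sym2 V → ℝ) (y : V) (S : Finset V) : ℝ :=
  (∏ s ∈ S, (1 - W s(y, s))) * psi W S

/-- Coefficients, up to sign, of the ratio of the partition functions with and without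
the additional points of a list, in an external field `u`. -/
def ratioCoeff (W : Sym2 V → ℝ) (u : V → ℝ) : List V → Finset V → ℝ
  | [], X => if X = ∅ then 1 else 0
  | y :: L, X => ∑ S ∈ X.powerset.attach,
      vertexW W y S.1 * (∏ s ∈ S.1, u s * listW W L s) * ratioCoeff W u (S.1.toList ++ L) (X \ S.1)
termination_by L X => (X.card, L.length)
decreasing_by
  have hS := Finset.mem_powerset.1 S.2
  rcases Finset.eq_empty_or_nonempty S.1 with h | h
  · simp [h, Prod.lex_def]
  · refine Prod.Lex.left _ _ (Finset.card_lt_card ?_)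
    exact Finset.sdiff_ssubset hS h

lemma ratioCoeff_nil (W : Sym2 V → ℝ) (u : V → ℝ) (X : Finset V) :
    ratioCoeff W u [] X = if X = ∅ then 1 else 0 := by rw [ratioCoeff]

lemma ratioCoeff_cons (W : Sym2 V → ℝ) (u : V → ℝ) (y : V) (L : List V) (X : Finset V) :
    ratioCoeff W u (y :: L) X = ∑ S ∈ X.powerset,
      vertexW W y S * (∏ s ∈ S, u s * listW W L s) * ratioCoeff W u (S.toList ++ L) (X \ S) := by
  rw [ratioCoeff]
  exact Finset.sum_attach X.powerset fun S =>
    vertexW W y S * (∏ s ∈ S, u s * listW W L s) * ratioCoeff W u (S.toList ++ L) (X \ S)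

/-- Induction along the recursion of `ratioCoeff`. -/
lemma ratio_induction {P : List V → Finset V → Prop} (nil : ∀ X, P [] X)
    (cons : ∀ y L X, (∀ S ⊆ X, P (S.toList ++ L) (X \ S)) → P (y :: L) X) :
    ∀ L X, P L X := by
  suffices H : ∀ n m : ℕ, ∀ (L : List V) (X : Finset V), X.card = n → L.length = m → P L X from
    fun L X => H _ _ L X rfl rfl
  intro n
  induction n using Nat.strong_induction_on with
  | _ n ihn =>
    intro m
    induction m with
    | zero =>
      intro L X _ hL
      rw [List.length_eq_zero_iff.1 hL]
      exact nil X
    | succ m ihm =>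
      intro L X hX hL
      obtain ⟨y, L, rfl⟩ := List.exists_cons_of_length_eq_add_one hL
      refine cons y L X fun S hS => ?_
      rcases Finset.eq_empty_or_nonempty S with rfl | h
      · simpa using ihm L X hX (by simpa using hL)
      · exact ihn _ (hX ▸ Finset.card_lt_card (Finset.sdiff_ssubset hS h)) _ _ _ rfl rfl

lemma psi_nonneg {W : Sym2 V → ℝ} (hW : ∀ e, 0 ≤ W e) (A : Finset V) : 0 ≤ psi W A :=
  Finset.prod_nonneg fun e _ => hW e

lemma vertexW_nonneg {W : Sym2 V → ℝ} (hW : ∀ e, 0 ≤ W e) (hW1 : ∀ e, W e ≤ 1) (y : V)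
    (S : Finset V) : 0 ≤ vertexW W y S :=
  mul_nonneg (Finset.prod_nonneg fun _ _ => sub_nonneg.2 (hW1 _)) (psi_nonneg hW S)

omit [DecidableEq V] in
lemma listW_nonneg {W : Sym2 V → ℝ} (hW : ∀ e, 0 ≤ W e) (L : List V) (x : V) :
    0 ≤ listW W L x :=
  List.prod_nonneg fun a ha => by
    obtain ⟨l, -, rfl⟩ := List.mem_map.1 ha
    exact hW _

omit [DecidableEq V] in
lemma listW_le_one {W : Sym2 V → ℝ} (hW : ∀ e, 0 ≤ W e) (hW1 : ∀ e, W e ≤ 1) (L : List V)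
    (x : V) : listW W L x ≤ 1 := by
  induction L with
  | nil => simp
  | cons y L ih =>
    rw [listW_cons]
    exact mul_le_one₀ (hW1 _) (listW_nonneg hW _ _) ih

lemma ratioCoeff_nonneg {W : Sym2 V → ℝ} {u : V → ℝ} (hW : ∀ e, 0 ≤ W e)
    (hW1 : ∀ e, W e ≤ 1) (hu : ∀ x, 0 ≤ u x) (L : List V) (X : Finset V) :
    0 ≤ ratioCoeff W u L X := by
  induction L, X using ratio_induction with
  | nil X => rw [ratioCoeff_nil]; split_ifs <;> norm_num
  | cons y L X ih =>
    rw [ratioCoeff_cons]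
    refine Finset.sum_nonneg fun S hS => mul_nonneg (mul_nonneg (vertexW_nonneg hW hW1 _ _)
      (Finset.prod_nonneg fun s _ => mul_nonneg (hu s) (listW_nonneg hW _ _)))
      (ih S (Finset.mem_powerset.1 hS))

/-- Switching on the interaction with one further point. -/
lemma psi_field_step (W : Sym2 V → ℝ) (v : V → ℝ) (y : V) (X : Finset V) :
    (-1) ^ X.card * psi W X * ∏ x ∈ X, (W s(y, x) * v x) =
      ∑ S ∈ X.powerset, vertexW W y S * (∏ s ∈ S, v s) *
        ((-1) ^ (X \ S).card * psi W (X \ S) * ∏ x ∈ X \ S, ((∏ s ∈ S, W s(s, x)) * v x)) := by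
  have h : (-1 : ℝ) ^ X.card * ∏ x ∈ X, W s(y, x) =
      ∑ S ∈ X.powerset, (∏ s ∈ S, (1 - W s(y, s))) * (-1) ^ (X \ S).card := by
    have := Finset.prod_add (fun s => 1 - W s(y, s)) (fun _ => (-1 : ℝ)) X
    simp only [Finset.prod_const] at this
    rw [← this, ← Finset.prod_const, ← Finset.prod_mul_distrib]
    exact Finset.prod_congr rfl fun x _ => by ring
  rw [Finset.prod_mul_distrib]
  calc _ = ((-1 : ℝ) ^ X.card * ∏ x ∈ X, W s(y, x)) * (psi W X * ∏ x ∈ X, v x) := by ring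
    _ = _ := by
      rw [h, Finset.sum_mul]
      refine Finset.sum_congr rfl fun S hS => ?_
      have hS := Finset.mem_powerset.1 hS
      rw [psi_split W hS, ← Finset.prod_sdiff hS, Finset.prod_mul_distrib, vertexW]
      ring

/-- The defining property of the coefficients: they are a quotient of set functions. -/
lemma ratioCoeff_conv (W : Sym2 V → ℝ) (L : List V) (X : Finset V) :
    ∑ T ∈ X.powerset, ratioCoeff W (fun _ => 1) L T * ((-1) ^ (X \ T).card * psi W (X \ T)) =
      (-1) ^ X.card * psi W X * ∏ x ∈ X, listW W L x := by
  induction L, X using ratio_induction with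
  | nil X =>
    rw [Finset.sum_eq_single ∅]
    · simp [ratioCoeff_nil]
    · intro T _ hT
      simp [ratioCoeff_nil, hT]
    · simp
  | cons y L X ih =>
    simp_rw [ratioCoeff_cons, Finset.sum_mul, one_mul]
    rw [sum_chain_eq X fun S T R => vertexW W y S * (∏ s ∈ S, listW W L s) *
      ratioCoeff W (fun _ => 1) (S.toList ++ L) T * ((-1) ^ R.card * psi W R)]
    simp_rw [mul_assoc _ (ratioCoeff W _ _ _), ← Finset.mul_sum, listW_cons]
    rw [psi_field_step]
    refine Finset.sum_congr rfl fun S hS => ?_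
    rw [ih S (Finset.mem_powerset.1 hS)]
    simp_rw [listW_append, listW_toList]

/-- Uniqueness of the quotient of set functions. -/
lemma eq_of_conv_eq (W : Sym2 V → ℝ) (A : Finset V) (k k' : Finset V → ℝ)
    (h : ∀ X ⊆ A, ∑ T ∈ X.powerset, k T * ((-1) ^ (X \ T).card * psi W (X \ T)) =
      ∑ T ∈ X.powerset, k' T * ((-1) ^ (X \ T).card * psi W (X \ T))) : k A = k' A := by
  induction A using Finset.strongInduction with
  | _ A ih =>
    have hA := h A le_rfl
    rw [← Finset.sum_erase_add _ _ (Finset.mem_powerset_self A),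
      ← Finset.sum_erase_add _ _ (Finset.mem_powerset_self A)] at hA
    have e : ∀ T ∈ A.powerset.erase A, k T = k' T := fun T hT => by
      simp only [Finset.mem_erase, Finset.mem_powerset] at hT
      exact ih T (Finset.ssubset_iff_subset_ne.2 ⟨hT.2, hT.1⟩) fun X hX => h X (hX.trans hT.2)
    rw [Finset.sum_congr rfl fun T hT => by rw [e T hT]] at hA
    simp only [Finset.sdiff_self, Finset.card_empty, pow_zero, psi_empty, mul_one] at hA
    exact add_left_cancel hA

/-- Multiplicativity of ratios: the last point of the list can be split off. -/
lemma ratioCoeff_append_singleton (W : Sym2 V → ℝ) (s : V) (L : List V) (X : Finset V) :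
    ratioCoeff W (fun _ => 1) (L ++ [s]) X = ∑ T ∈ X.powerset,
      ratioCoeff W (fun _ => 1) [s] T * ratioCoeff W (fun x => W s(s, x)) L (X \ T) := by
  induction L, X using ratio_induction with
  | nil X =>
    rw [Finset.sum_eq_single X]
    · simp [ratioCoeff_nil]
    · intro T hT hTX
      have : X \ T ≠ ∅ := fun h => hTX
        (Finset.Subset.antisymm (Finset.mem_powerset.1 hT) (Finset.sdiff_eq_empty_iff_subset.1 h))
      simp [ratioCoeff_nil, this]
    · simp
  | cons y L X ih =>
    rw [List.cons_append, ratioCoeff_cons]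
    simp_rw [ratioCoeff_cons W (fun x => W s(s, x)) y L, Finset.mul_sum]
    rw [← sum_disjoint_pairs_comm X fun S T R => ratioCoeff W (fun _ => 1) [s] T *
      (vertexW W y S * (∏ x ∈ S, W s(s, x) * listW W L x) *
        ratioCoeff W (fun x => W s(s, x)) (S.toList ++ L) R)]
    refine Finset.sum_congr rfl fun S hS => ?_
    rw [← List.append_assoc, ih S (Finset.mem_powerset.1 hS), Finset.mul_sum]
    refine Finset.sum_congr rfl fun T _ => ?_
    simp_rw [listW_append, listW_cons, listW_nil, one_mul, mul_one, mul_comm (listW W L _)]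
    ring

end Combinatorics

section Graphs

variable {V : Type*} [DecidableEq V]

/-- `x` is joined to `a` by a path of edges in `E`. -/
def EdgeJoined (E : Finset (Sym2 V)) (a x : V) : Prop :=
  Relation.ReflTransGen (fun x y => s(x, y) ∈ E) a x

/-- All points of `A` are joined to `a`. -/
def RootConnected (E : Finset (Sym2 V)) (a : V) (A : Finset V) : Prop :=
  ∀ x ∈ A, EdgeJoined E a x

/-- The sum over connected graphs on the finite set `A` containing the root `a`. -/
def connSum (f : Sym2 V → ℝ) (a : V) (A : Finset V) : ℝ :=
  ∑ E ∈ (pairsOf A).powerset with RootConnected E a A, ∏ e ∈ E, f e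

omit [DecidableEq V] in
lemma EdgeJoined.mono {E E' : Finset (Sym2 V)} (h : E ⊆ E') {a x : V} (hx : EdgeJoined E a x) :
    EdgeJoined E' a x :=
  Relation.ReflTransGen.mono (fun _ _ he => h he) _ _ hx

lemma pairsOf_mono {A B : Finset V} (h : A ⊆ B) : pairsOf A ⊆ pairsOf B :=
  Finset.filter_subset_filter _ (Finset.sym2_mono h)

lemma disjoint_pairsOf {A B : Finset V} (h : Disjoint A B) :
    Disjoint (pairsOf A) (pairsOf B) := by
  rw [Finset.disjoint_left] at h ⊢
  intro e
  induction e using Sym2.ind with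
  | _ x y => exact fun h1 h2 => h (mk_mem_pairsOf.1 h1).1 (mk_mem_pairsOf.1 h2).1

/-- Decomposition of graphs according to the connected component of the root. -/
lemma psi_insert_eq_sum_connSum (W : Sym2 V → ℝ) {a : V} {X : Finset V} (ha : a ∉ X) :
    psi W (insert a X) =
      ∑ T ∈ X.powerset, connSum (fun e => W e - 1) a (insert a T) * psi W (X \ T) := by
  have key : ∀ A : Finset V, psi W A = ∑ E ∈ (pairsOf A).powerset, ∏ e ∈ E, (W e - 1) := by
    intro A
    rw [← Finset.prod_one_add, psi]
    exact Finset.prod_congr rfl fun e _ => by ring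
  rw [key, ← Finset.sum_fiberwise_of_maps_to (t := X.powerset)
    (g := fun E => X.filter fun x => EdgeJoined E a x)
    (fun E _ => Finset.mem_powerset.2 (Finset.filter_subset _ _))]
  refine Finset.sum_congr rfl fun T hT => ?_
  have hTX := Finset.mem_powerset.1 hT
  have haT : a ∉ T := fun h => ha (hTX h)
  have hdisj : Disjoint (insert a T) (X \ T) := by
    rw [Finset.disjoint_left]
    intro x hx hx'
    rcases Finset.mem_insert.1 hx with rfl | hx
    · exact ha (Finset.mem_sdiff.1 hx').1
    · exact (Finset.mem_sdiff.1 hx').2 hx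
  have hP := disjoint_pairsOf hdisj
  rw [key, connSum, Finset.sum_mul_sum, ← Finset.sum_product']
  have split : ∀ E ∈ (pairsOf (insert a X)).powerset.filter
      (fun E => X.filter (fun x => EdgeJoined E a x) = T), ∀ e ∈ E,
      e ∈ pairsOf (insert a T) ∨ e ∈ pairsOf (X \ T) := by
    intro E hE e he
    obtain ⟨hE, hc⟩ := Finset.mem_filter.1 hE
    have hE := Finset.mem_powerset.1 hE
    have hmem : ∀ x, x ∈ insert a X → (x ∈ insert a T ↔ EdgeJoined E a x) := by
      intro x hx
      rcases Finset.mem_insert.1 hx with rfl | hx'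
      · simp [EdgeJoined, Relation.ReflTransGen.refl]
      · have : x ≠ a := fun h => ha (h ▸ hx')
        rw [← hc]
        simp [this, hx']
    have hee := hE he
    induction e using Sym2.ind with
    | _ x y =>
      rw [mk_mem_pairsOf] at hee ⊢
      rw [mk_mem_pairsOf]
      by_cases hx : EdgeJoined E a x
      · have hy : EdgeJoined E a y := hx.tail he
        exact Or.inl ⟨(hmem x hee.1).2 hx, (hmem y hee.2.1).2 hy, hee.2.2⟩
      · have hy : ¬ EdgeJoined E a y := fun hy => hx (hy.tail (by rwa [Sym2.eq_swap]))
        refine Or.inr ⟨?_, ?_, hee.2.2⟩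
        · have := (hmem x hee.1).not.2 hx
          have h1 := hee.1
          simp only [Finset.mem_insert, Finset.mem_sdiff] at this h1 ⊢
          tauto
        · have := (hmem y hee.2.1).not.2 hy
          have h1 := hee.2.1
          simp only [Finset.mem_insert, Finset.mem_sdiff] at this h1 ⊢
          tauto
  refine Finset.sum_bij' (fun E _ => (E ∩ pairsOf (insert a T), E ∩ pairsOf (X \ T)))
    (fun p _ => p.1 ∪ p.2) ?_ ?_ ?_ ?_ ?_
  · intro E hE
    have hsp := split E hE
    obtain ⟨hE, hc⟩ := Finset.mem_filter.1 hE
    simp only [Finset.mem_product, Finset.mem_filter, Finset.mem_powerset]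
    refine ⟨⟨Finset.inter_subset_right, ?_⟩, Finset.inter_subset_right⟩
    have hj : ∀ x, EdgeJoined E a x →
        x ∈ insert a T ∧ EdgeJoined (E ∩ pairsOf (insert a T)) a x := by
      intro x hx
      induction hx with
      | refl => exact ⟨Finset.mem_insert_self _ _, Relation.ReflTransGen.refl⟩
      | @tail y z _ hyz ih =>
        have : s(y, z) ∈ pairsOf (insert a T) := (hsp _ hyz).resolve_right fun h =>
          Finset.disjoint_left.1 hdisj ih.1 (mk_mem_pairsOf.1 h).1
        exact ⟨(mk_mem_pairsOf.1 this).2.1, ih.2.tail (Finset.mem_inter.2 ⟨hyz, this⟩)⟩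
    intro x hx
    rcases Finset.mem_insert.1 hx with rfl | hx
    · exact Relation.ReflTransGen.refl
    · rw [← hc] at hx
      exact (hj x (Finset.mem_filter.1 hx).2).2
  · intro p hp
    simp only [Finset.mem_product, Finset.mem_filter, Finset.mem_powerset] at hp ⊢
    obtain ⟨⟨h1, hc⟩, h2⟩ := hp
    refine ⟨Finset.union_subset (h1.trans (pairsOf_mono (Finset.insert_subset_insert a hTX)))
      (h2.trans (pairsOf_mono (Finset.sdiff_subset.trans (Finset.subset_insert a X)))), ?_⟩
    have hj : ∀ x, EdgeJoined (p.1 ∪ p.2) a x → x ∈ insert a T := by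
      intro x hx
      induction hx with
      | refl => exact Finset.mem_insert_self _ _
      | @tail y z _ hyz ih =>
        rcases Finset.mem_union.1 hyz with h | h
        · exact (mk_mem_pairsOf.1 (h1 h)).2.1
        · exact absurd (mk_mem_pairsOf.1 (h2 h)).1 (Finset.disjoint_left.1 hdisj ih)
    ext x
    rw [Finset.mem_filter]
    constructor
    · rintro ⟨hx, hx'⟩
      rcases Finset.mem_insert.1 (hj x hx') with rfl | h
      · exact absurd hx ha
      · exact h
    · exact fun hx => ⟨hTX hx,
        (hc x (Finset.mem_insert_of_mem hx)).mono Finset.subset_union_left⟩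
  · intro E hE
    ext e
    have := split E hE e
    simp only [Finset.mem_union, Finset.mem_inter]
    tauto
  · intro p hp
    simp only [Finset.mem_product, Finset.mem_filter, Finset.mem_powerset] at hp
    obtain ⟨⟨h1, -⟩, h2⟩ := hp
    have d1 : ∀ e ∈ p.1, e ∉ pairsOf (X \ T) := fun e he =>
      Finset.disjoint_left.1 hP (h1 he)
    have d2 : ∀ e ∈ p.2, e ∉ pairsOf (insert a T) := fun e he =>
      Finset.disjoint_right.1 hP (h2 he)
    ext e
    · have := @h1 e; have := d2 e
      simp only [Finset.mem_union, Finset.mem_inter]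
      tauto
    · have := @h2 e; have := d1 e
      simp only [Finset.mem_union, Finset.mem_inter]
      tauto
  · intro E hE
    rw [← Finset.prod_union]
    · congr 1
      ext e
      have := split E hE e
      simp only [Finset.mem_union, Finset.mem_inter]
      tauto
    · exact hP.mono Finset.inter_subset_right Finset.inter_subset_right

/-- For a single point the ratio coefficients are the signed truncated weights. -/
lemma ratioCoeff_singleton (W : Sym2 V → ℝ) {a : V} {X : Finset V} (ha : a ∉ X) :
    ratioCoeff W (fun _ => 1) [a] X =
      (-1) ^ X.card * connSum (fun e => W e - 1) a (insert a X) := by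
  refine eq_of_conv_eq W X _
    (fun T => (-1) ^ T.card * connSum (fun e => W e - 1) a (insert a T)) fun Y hY => ?_
  have haY : a ∉ Y := fun h => ha (hY h)
  rw [ratioCoeff_conv]
  have : ∀ T ∈ Y.powerset, (-1) ^ T.card * connSum (fun e => W e - 1) a (insert a T) *
      ((-1) ^ (Y \ T).card * psi W (Y \ T)) =
      (-1) ^ Y.card * (connSum (fun e => W e - 1) a (insert a T) * psi W (Y \ T)) := by
    intro T hT
    rw [← Finset.card_sdiff_add_card_eq_card (Finset.mem_powerset.1 hT), pow_add]
    ring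
  rw [Finset.sum_congr rfl this, ← Finset.mul_sum, ← psi_insert_eq_sum_connSum W haY,
    psi_insert W haY]
  simp only [listW_cons, listW_nil, mul_one]
  ring

variable {V' : Type*} [DecidableEq V']

lemma psi_map (W : Sym2 V → ℝ) (e : V' ↪ V) (A : Finset V') :
    psi W (A.map e) = psi (fun b => W (b.map e)) A := by
  induction A using Finset.induction_on with
  | empty => simp
  | insert a A ha ih =>
    rw [Finset.map_insert, psi_insert _ (by simpa using ha), psi_insert _ ha, ih,
      Finset.prod_map]
    rfl

/-- Relabelling of ratio coefficients. -/
lemma ratioCoeff_map (W : Sym2 V → ℝ) (e : V' ↪ V) (L : List V') (X : Finset V') :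
    ratioCoeff W (fun _ => 1) (L.map e) (X.map e) =
      ratioCoeff (fun b => W (b.map e)) (fun _ => 1) L X := by
  refine eq_of_conv_eq (fun b => W (b.map e)) X
    (fun T => ratioCoeff W (fun _ => 1) (L.map e) (T.map e)) _ fun Y _ => ?_
  rw [ratioCoeff_conv]
  have h := ratioCoeff_conv W (L.map e) (Y.map e)
  have hp : (Y.map e).powerset = Y.powerset.map ⟨Finset.map e, Finset.map_injective e⟩ := by
    ext T
    simp [Finset.subset_map_iff, eq_comm]
  rw [hp, Finset.sum_map] at h
  simp only [Function.Embedding.coeFn_mk, ← Finset.map_sdiff, Finset.card_map, psi_map,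
    Finset.prod_map] at h
  rw [h]
  simp only [listW, List.map_map]
  rfl

end Graphs

/-- A symmetric pair weight, as a function of the edges of the graph on the labels. -/
def edgeW {V S : Type*} (w : S → S → ℝ) (hw : ∀ x y, w x y = w y x) (p : V → S) :
    Sym2 V → ℝ :=
  Sym2.lift ⟨fun i j => w (p i) (p j), fun i j => hw (p i) (p j)⟩

@[simp] lemma edgeW_mk {V S : Type*} (w : S → S → ℝ) (hw : ∀ x y, w x y = w y x) (p : V → S)
    (i j : V) : edgeW w hw p s(i, j) = w (p i) (p j) := rfl

lemma prod_edges_eq_prod_pairs {n : ℕ} (W : Sym2 (Fin n) → ℝ) (E : Finset (Sym2 (Fin n)))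
    (hE : ∀ e ∈ E, ¬ e.IsDiag) :
    ∏ e ∈ E, W e = ∏ p ∈ Finset.univ.filter
      (fun p : Fin n × Fin n => p.1 < p.2 ∧ s(p.1, p.2) ∈ E), W s(p.1, p.2) := by
  symm
  refine Finset.prod_bij (fun p _ => s(p.1, p.2)) ?_ ?_ ?_ ?_
  · intro p hp; exact (Finset.mem_filter.1 hp).2.2
  · rintro ⟨a, b⟩ hp ⟨c, d⟩ hq h
    simp only [Finset.mem_filter, Finset.mem_univ, true_and] at hp hq
    rcases Sym2.eq_iff.1 h with ⟨h1, h2⟩ | ⟨h1, h2⟩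
    · exact Prod.ext h1 h2
    · simp only at h1 h2
      subst h1 h2
      exact absurd hp.1 hq.1.asymm
  · intro e he
    induction e using Sym2.ind with
    | _ x y =>
      have hxy : x ≠ y := by simpa using hE _ he
      rcases lt_or_gt_of_ne hxy with h | h
      · exact ⟨(x, y), by simp [h, he], rfl⟩
      · exact ⟨(y, x), by simp [h, Sym2.eq_swap, he], Sym2.eq_swap⟩
  · intro p _; rfl

lemma omegaT_eq_connSum {S : Type*} (w : S → S → ℝ) (hw : ∀ x y, w x y = w y x) (n : ℕ)
    (x : Fin (n + 1) → S) :
    omegaT w (n + 1) x = connSum (fun e => edgeW w hw x e - 1) 0 Finset.univ := by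
  rw [omegaT, connSum, ← Finset.sum_filter]
  refine Finset.sum_bij' (fun G _ => G.edgeFinset)
    (fun E _ => SimpleGraph.fromEdgeSet (E : Set (Sym2 (Fin (n + 1))))) ?_ ?_ ?_ ?_ ?_
  · intro G hG
    have hG := (Finset.mem_filter.1 hG).2
    rw [Finset.mem_filter, Finset.mem_powerset]
    constructor
    · intro e he
      simp only [pairsOf, Finset.mem_filter, Finset.mem_sym2_iff, Finset.mem_univ, implies_true,
        true_and]
      exact G.not_isDiag_of_mem_edgeSet (SimpleGraph.mem_edgeFinset.1 he)
    · intro y _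
      have := (SimpleGraph.reachable_iff_reflTransGen 0 y).1 (hG.preconnected 0 y)
      exact Relation.ReflTransGen.mono (fun a b hab => by simpa using hab) _ _ this
  · intro E hE
    simp only [Finset.mem_filter, Finset.mem_powerset] at hE
    simp only [Finset.mem_filter, Finset.mem_univ, true_and]
    have h0 : ∀ y, (SimpleGraph.fromEdgeSet (E : Set (Sym2 (Fin (n + 1))))).Reachable 0 y := by
      intro y
      rw [SimpleGraph.reachable_iff_reflTransGen]
      refine Relation.ReflTransGen.mono (fun a b hab => ?_) _ _ (hE.2 y (Finset.mem_univ y))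
      rw [SimpleGraph.fromEdgeSet_adj]
      exact ⟨hab, (mk_mem_pairsOf.1 (hE.1 hab)).2.2⟩
    exact ⟨fun a b => (h0 a).symm.trans (h0 b)⟩
  · intro G _
    simp
  · intro E hE
    simp only [Finset.mem_filter, Finset.mem_powerset] at hE
    ext e
    have : e ∈ E → ¬ e.IsDiag := fun he => (Finset.mem_filter.1 (hE.1 he)).2
    simp only [SimpleGraph.mem_edgeFinset, SimpleGraph.edgeSet_fromEdgeSet, Set.mem_sdiff,
      Finset.mem_coe]
    exact ⟨fun h => h.1, fun h => ⟨h, this h⟩⟩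
  · intro G _
    rw [prod_edges_eq_prod_pairs]
    · simp
    · exact fun e he => G.not_isDiag_of_mem_edgeSet (SimpleGraph.mem_edgeFinset.1 he)

lemma psi_univ_eq {S : Type*} (w : S → S → ℝ) (hw : ∀ x y, w x y = w y x) (n : ℕ)
    (x : Fin n → S) :
    psi (edgeW w hw x) Finset.univ =
      ∏ p ∈ Finset.univ.filter (fun p : Fin n × Fin n => p.1 < p.2), w (x p.1) (x p.2) := by
  rw [psi, prod_edges_eq_prod_pairs _ (pairsOf Finset.univ)
    fun e he => (Finset.mem_filter.1 he).2]
  refine Finset.prod_congr ?_ fun p _ => rfl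
  ext p
  simp only [Finset.mem_filter, Finset.mem_univ, true_and, mk_mem_pairsOf]
  exact ⟨fun h => h.1, fun h => ⟨h, h.ne⟩⟩

section RatioDependence

variable {V : Type*} [DecidableEq V]

lemma psi_congr {W W' : Sym2 V → ℝ} {A : Finset V}
    (h : ∀ x ∈ A, ∀ y ∈ A, W s(x, y) = W' s(x, y)) : psi W A = psi W' A := by
  refine Finset.prod_congr rfl fun e => ?_
  induction e using Sym2.ind with
  | _ x y =>
    intro he
    rw [mk_mem_pairsOf] at he
    exact h x he.1 y he.2.1

lemma vertexW_congr {W W' : Sym2 V → ℝ} {y : V} {S : Finset V}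
    (h : ∀ x ∈ insert y S, ∀ z ∈ S, W s(x, z) = W' s(x, z)) : vertexW W y S = vertexW W' y S := by
  rw [vertexW, vertexW, psi_congr fun x hx z hz => h x (Finset.mem_insert_of_mem hx) z hz]
  congr 1
  exact Finset.prod_congr rfl fun s hs => by rw [h y (Finset.mem_insert_self _ _) s hs]

omit [DecidableEq V] in
lemma listW_congr {W W' : Sym2 V → ℝ} {L : List V} {x : V}
    (h : ∀ l ∈ L, W s(l, x) = W' s(l, x)) : listW W L x = listW W' L x := by
  rw [listW, listW, List.map_congr_left h]

lemma ratioCoeff_congr {W W' : Sym2 V → ℝ} {u u' : V → ℝ} (L : List V) (X : Finset V)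
    (h : ∀ x, (x ∈ L ∨ x ∈ X) → ∀ z ∈ X, W s(x, z) = W' s(x, z)) (hu : ∀ x ∈ X, u x = u' x) :
    ratioCoeff W u L X = ratioCoeff W' u' L X := by
  induction L, X using ratio_induction with
  | nil X => rw [ratioCoeff_nil, ratioCoeff_nil]
  | cons y L X ih =>
    rw [ratioCoeff_cons, ratioCoeff_cons]
    refine Finset.sum_congr rfl fun S hS => ?_
    have hS := Finset.mem_powerset.1 hS
    congr 1
    · congr 1
      · refine vertexW_congr fun x hx z hz => h x ?_ z (hS hz)
        rcases Finset.mem_insert.1 hx with rfl | hx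
        · exact Or.inl List.mem_cons_self
        · exact Or.inr (hS hx)
      · refine Finset.prod_congr rfl fun s hs => ?_
        rw [hu s (hS hs), listW_congr fun l hl =>
          h l (Or.inl (List.mem_cons_of_mem _ hl)) s (hS hs)]
    · refine ih S hS (fun x hx z hz => h x ?_ z (Finset.sdiff_subset hz))
        fun x hx => hu x (Finset.sdiff_subset hx)
      simp only [List.mem_append, Finset.mem_toList] at hx
      rcases hx with (hx | hx) | hx
      · exact Or.inr (hS hx)
      · exact Or.inl (List.mem_cons_of_mem _ hx)
      · exact Or.inr (Finset.sdiff_subset hx)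

end RatioDependence

section Marginals

variable {ι E : Type*} [DecidableEq ι] [MeasureSpace E] [SigmaFinite (volume : Measure E)]

omit [SigmaFinite (volume : Measure E)] in
lemma lmarginal_mul_left {T : Finset ι} {c f : (ι → E) → ℝ≥0∞} (hf : Measurable f)
    {p : ι → E} (hc : ∀ q : ι → E, (∀ i ∉ T, q i = p i) → c q = c p) :
    lmarginal (fun _ => volume) T (fun q => c q * f q) p =
      c p * lmarginal (fun _ => volume) T f p := by
  simp only [lmarginal]
  have hm : Measurable fun z : T → E => f (Function.updateFinset p T z) :=
    hf.comp measurable_updateFinset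
  rw [← lintegral_const_mul _ hm]
  refine lintegral_congr fun z => ?_
  rw [hc _ fun i hi => by simp [Function.updateFinset, hi]]

omit [SigmaFinite (volume : Measure E)] in
lemma lmarginal_sum {κ : Type*} {T : Finset ι} (A : Finset κ) (f : κ → (ι → E) → ℝ≥0∞)
    (hf : ∀ k ∈ A, Measurable (f k)) (p : ι → E) :
    lmarginal (fun _ => volume) T (fun q => ∑ k ∈ A, f k q) p =
      ∑ k ∈ A, lmarginal (fun _ => volume) T (f k) p := by
  simp only [lmarginal]
  exact lintegral_finsetSum' _ fun k hk => ((hf k hk).comp measurable_updateFinset).aemeasurable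

lemma lmarginal_sdiff {S X : Finset ι} (h : S ⊆ X) {f : (ι → E) → ℝ≥0∞} (hf : Measurable f) :
    lmarginal (fun _ => volume) X f =
      lmarginal (fun _ => volume) S (lmarginal (fun _ => volume) (X \ S) f) := by
  conv_lhs => rw [← Finset.union_sdiff_of_subset h]
  exact lmarginal_union _ _ hf Finset.disjoint_sdiff

end Marginals

/-- A bounded translation-invariant repulsive pair weight. -/
structure IsRepulsive {d : ℕ} (w : (Fin d → ℝ) → (Fin d → ℝ) → ℝ) : Prop where
  symm : ∀ x y, w x y = w y x
  meas : Measurable (Function.uncurry w)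
  nonneg : ∀ x y, 0 ≤ w x y
  le_one : ∀ x y, w x y ≤ 1
  trans : ∀ v x y, w (x + v) (y + v) = w x y

section Integrals

variable {d : ℕ} {w : (Fin d → ℝ) → (Fin d → ℝ) → ℝ} (hw : IsRepulsive w)

/-- The integrated vertex weight. -/
def vertexInt (w : (Fin d → ℝ) → (Fin d → ℝ) → ℝ) (n : ℕ) : ℝ≥0∞ :=
  ∫⁻ y : Fin n → Fin d → ℝ, ENNReal.ofReal (phiVertex w n 0 y)

/-- The integral of the signed truncated weight. -/
def clusterInt (w : (Fin d → ℝ) → (Fin d → ℝ) → ℝ) (n : ℕ) : ℝ≥0∞ :=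
  ∫⁻ y : Fin n → Fin d → ℝ, ENNReal.ofReal ((-1) ^ n * omegaT w (n + 1) (Fin.cons 0 y))

/-- Integrating a translation-invariant function of the points `y`, `S` over `S`. -/
lemma lmarginal_translation {n : ℕ} (e : Fin n ↪ ℕ) {y : ℕ} (hy : y ∉ Finset.univ.map e)
    (h : (Fin d → ℝ) → (Fin n → Fin d → ℝ) → ℝ≥0∞)
    (ht : ∀ v x q, h (x + v) (fun i => q i + v) = h x q) (p : ℕ → Fin d → ℝ) :
    lmarginal (fun _ => volume) (Finset.univ.map e) (fun p => h (p y) (fun i => p (e i))) p =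
      ∫⁻ q : Fin n → Fin d → ℝ, h 0 q := by
  let e1 : Fin n ≃ (Finset.univ.map e : Finset ℕ) :=
    (Equiv.ofInjective e e.injective).trans (Equiv.subtypeEquivRight fun x => by simp)
  have h1 : ∀ i, ((e1 i : (Finset.univ.map e : Finset ℕ)) : ℕ) = e i := fun _ => rfl
  have hmp := volume_measurePreserving_piCongrLeft
    (fun _ : (Finset.univ.map e : Finset ℕ) => Fin d → ℝ) e1
  rw [lmarginal, ← volume_pi, ← hmp.lintegral_comp_emb (MeasurableEquiv.measurableEmbedding _)]
  have h2 : ∀ q : Fin n → Fin d → ℝ, ∀ i, Function.updateFinset p (Finset.univ.map e)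
      (MeasurableEquiv.piCongrLeft (fun _ => Fin d → ℝ) e1 q) (e i) = q i := by
    intro q i
    rw [Function.updateFinset, dif_pos (by simp), MeasurableEquiv.coe_piCongrLeft]
    exact Equiv.piCongrLeft_apply_apply (fun _ => Fin d → ℝ) e1 q i
  have h3 : ∀ q, Function.updateFinset p (Finset.univ.map e) q y = p y := by
    intro q
    rw [Function.updateFinset, dif_neg hy]
  simp only [h2, h3]
  rw [← lintegral_add_right_eq_self (fun q => h (p y) q) fun _ => p y]
  refine lintegral_congr fun q => ?_
  have := ht (p y) 0 q
  rw [zero_add] at this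
  exact this

include hw

lemma edgeW_nonneg (p : ℕ → Fin d → ℝ) (e : Sym2 ℕ) : 0 ≤ edgeW w hw.symm p e := by
  induction e using Sym2.ind with
  | _ x y => exact hw.nonneg _ _

lemma edgeW_le_one (p : ℕ → Fin d → ℝ) (e : Sym2 ℕ) : edgeW w hw.symm p e ≤ 1 := by
  induction e using Sym2.ind with
  | _ x y => exact hw.le_one _ _

lemma measurable_edgeW {V : Type*} (e : Sym2 V) :
    Measurable fun p : V → Fin d → ℝ => edgeW w hw.symm p e := by
  induction e using Sym2.ind with
  | _ x y =>
    have : Measurable fun p : V → Fin d → ℝ => Function.uncurry w (p x, p y) :=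
      hw.meas.comp ((measurable_pi_apply x).prodMk (measurable_pi_apply y))
    exact this

lemma measurable_vertexW (y : ℕ) (S : Finset ℕ) :
    Measurable fun p : ℕ → Fin d → ℝ => vertexW (edgeW w hw.symm p) y S :=
  (Finset.measurable_prod _ fun _ _ => measurable_const.sub (measurable_edgeW hw _)).mul
    (Finset.measurable_prod _ fun _ _ => measurable_edgeW hw _)

lemma measurable_listW (L : List ℕ) (x : ℕ) :
    Measurable fun p : ℕ → Fin d → ℝ => listW (edgeW w hw.symm p) L x := by
  induction L with
  | nil => exact measurable_const
  | cons y L ih =>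
    simp only [listW_cons]
    exact (measurable_edgeW hw _).mul ih

lemma measurable_ratioCoeff {u : (ℕ → Fin d → ℝ) → ℕ → ℝ} (hu : ∀ x, Measurable fun p => u p x)
    (L : List ℕ) (X : Finset ℕ) :
    Measurable fun p : ℕ → Fin d → ℝ => ratioCoeff (edgeW w hw.symm p) (u p) L X := by
  induction L, X using ratio_induction with
  | nil X => simp only [ratioCoeff_nil]; exact measurable_const
  | cons y L X ih =>
    simp only [ratioCoeff_cons]
    exact Finset.measurable_sum _ fun S hS => ((measurable_vertexW hw y S).mul
      (Finset.measurable_prod _ fun s _ => (hu s).mul (measurable_listW hw L s))).mul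
      (ih S (Finset.mem_powerset.1 hS))

lemma measurable_omegaT {n : ℕ} : Measurable fun x : Fin n → Fin d → ℝ => omegaT w n x := by
  refine Finset.measurable_sum _ fun G _ => ?_
  split_ifs
  · refine Finset.measurable_prod _ fun p _ => ?_
    have : Measurable fun x : Fin n → Fin d → ℝ => Function.uncurry w (x p.1, x p.2) :=
      hw.meas.comp ((measurable_pi_apply p.1).prodMk (measurable_pi_apply p.2))
    exact this.sub_const 1
  · exact measurable_const

omit hw in
lemma exists_embedding (X : Finset ℕ) : ∃ e : Fin X.card ↪ ℕ, Finset.univ.map e = X :=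
  ⟨(X.orderEmbOfFin rfl).toEmbedding, by simp⟩

lemma vertexW_eq_phiVertex {n : ℕ} (e : Fin n ↪ ℕ) (y : ℕ) (p : ℕ → Fin d → ℝ) :
    vertexW (edgeW w hw.symm p) y (Finset.univ.map e) = phiVertex w n (p y) fun i => p (e i) := by
  rw [vertexW, phiVertex, Finset.prod_map, psi_map,
    ← psi_univ_eq w hw.symm n fun i => p (e i)]
  simp only [edgeW_mk]
  congr 2
  ext b
  induction b using Sym2.ind with
  | _ i j => rfl

lemma lmarginal_vertexW {y : ℕ} {S : Finset ℕ} (hy : y ∉ S) (p : ℕ → Fin d → ℝ) :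
    lmarginal (fun _ => volume) S
      (fun p => ENNReal.ofReal (vertexW (edgeW w hw.symm p) y S)) p = vertexInt w S.card := by
  obtain ⟨e, he⟩ := exists_embedding S
  have := lmarginal_translation (d := d) e (y := y) (by rwa [he])
    (fun x q => ENNReal.ofReal (phiVertex w S.card x q))
    (fun v x q => by simp only [phiVertex, hw.trans]) p
  rw [vertexInt, ← this, he]
  congr 1
  ext p
  rw [← vertexW_eq_phiVertex hw, he]

lemma ratioCoeff_singleton_eq_omegaT {n : ℕ} (e : Fin n ↪ ℕ) {y : ℕ}
    (hy : y ∉ Finset.univ.map e) (p : ℕ → Fin d → ℝ) :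
    ratioCoeff (edgeW w hw.symm p) (fun _ => 1) [y] (Finset.univ.map e) =
      (-1) ^ n * omegaT w (n + 1) (Fin.cons (p y) fun i => p (e i)) := by
  have hy' : ∀ i, e i ≠ y := fun i h => hy (by simp [← h])
  let e' : Fin (n + 1) ↪ ℕ := ⟨Fin.cons y e, Fin.cons_injective_iff.2
    ⟨by rintro ⟨i, hi⟩; exact hy' i hi, e.injective⟩⟩
  have h1 : Finset.univ.map e = ((Finset.univ : Finset (Fin n)).map (Fin.succEmb n)).map e' := by
    rw [Finset.map_map]
    congr 1
  have h0 : (0 : Fin (n + 1)) ∉ (Finset.univ : Finset (Fin n)).map (Fin.succEmb n) := by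
    simp
  have h2 : ([y] : List ℕ) = [(0 : Fin (n + 1))].map e' := by simp [e']
  rw [h1, h2, ratioCoeff_map, ratioCoeff_singleton _ h0, omegaT_eq_connSum w hw.symm]
  have h3 : insert (0 : Fin (n + 1))
      ((Finset.univ : Finset (Fin n)).map (Fin.succEmb n)) = Finset.univ := by
    ext i
    refine Fin.cases ?_ (fun j => ?_) i <;> simp
  rw [h3]
  simp only [Finset.card_map, Finset.card_univ, Fintype.card_fin]
  congr 2
  ext b
  congr 1
  induction b using Sym2.ind with
  | _ i j =>
    have : ∀ i, p (e' i) = (Fin.cons (p y) fun i => p (e i) : Fin (n + 1) → Fin d → ℝ) i :=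
      fun i => Fin.cases rfl (fun _ => rfl) i
    simp [this]

lemma omegaT_sign_nonneg {n : ℕ} (q : Fin n → Fin d → ℝ) (x : Fin d → ℝ) :
    0 ≤ (-1) ^ n * omegaT w (n + 1) (Fin.cons x q) := by
  have := ratioCoeff_nonneg (u := fun _ => 1)
    (edgeW_nonneg hw fun i => if h : i < n then q ⟨i, h⟩ else x)
    (edgeW_le_one hw fun i => if h : i < n then q ⟨i, h⟩ else x) (fun _ => zero_le_one) [n]
    ((Finset.univ : Finset (Fin n)).map Fin.valEmbedding)
  rw [ratioCoeff_singleton_eq_omegaT hw Fin.valEmbedding (by simp)] at this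
  simpa using this

lemma lmarginal_ratioCoeff_singleton {y : ℕ} {X : Finset ℕ} (hy : y ∉ X) (p : ℕ → Fin d → ℝ) :
    lmarginal (fun _ => volume) X
      (fun p => ENNReal.ofReal (ratioCoeff (edgeW w hw.symm p) (fun _ => 1) [y] X)) p =
      clusterInt w X.card := by
  obtain ⟨e, he⟩ := exists_embedding X
  have := lmarginal_translation (d := d) e (y := y) (by rwa [he])
    (fun x q => ENNReal.ofReal ((-1) ^ X.card * omegaT w (X.card + 1) (Fin.cons x q)))
    (fun v x q => by
      have : (Fin.cons (x + v) fun i => q i + v : Fin (X.card + 1) → Fin d → ℝ) =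
          fun i => (Fin.cons x q : Fin (X.card + 1) → Fin d → ℝ) i + v := by
        ext1 i
        refine Fin.cases rfl (fun _ => rfl) i
      simp only [this, omegaT, hw.trans]) p
  rw [clusterInt, ← this, he]
  congr 1
  ext p
  rw [← ratioCoeff_singleton_eq_omegaT hw e (by rwa [he]), he]

end Integrals

section ForestBound

/-- The normalised majorant of the integrated ratio coefficients with `ℓ` roots. -/
def forestCoeff (g : ℕ → ℝ≥0∞) : ℕ → ℕ → ℝ≥0∞
  | 0, n => if n = 0 then 1 else 0
  | ℓ + 1, n => ∑ s ∈ (Finset.range (n + 1)).attach, g s.1 * forestCoeff g (s.1 + ℓ) (n - s.1)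
termination_by ℓ n => (n, ℓ)
decreasing_by
  have hs := Finset.mem_range.1 s.2
  rcases Nat.eq_zero_or_pos s.1 with h | h
  · simp [h, Prod.lex_def]
  · exact Prod.Lex.left _ _ (by omega)

lemma forestCoeff_zero (g : ℕ → ℝ≥0∞) (n : ℕ) :
    forestCoeff g 0 n = if n = 0 then 1 else 0 := by rw [forestCoeff]

lemma forestCoeff_succ (g : ℕ → ℝ≥0∞) (ℓ n : ℕ) : forestCoeff g (ℓ + 1) n =
    ∑ s ∈ Finset.range (n + 1), g s * forestCoeff g (s + ℓ) (n - s) := by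
  rw [forestCoeff]
  exact Finset.sum_attach (Finset.range (n + 1)) fun s => g s * forestCoeff g (s + ℓ) (n - s)

lemma sum_range_triangle {M : Type*} [AddCommMonoid M] (f : ℕ → ℕ → M) (N : ℕ) :
    ∑ n ∈ Finset.range (N + 1), ∑ s ∈ Finset.range (n + 1), f s (n - s) =
      ∑ s ∈ Finset.range (N + 1), ∑ t ∈ Finset.range (N - s + 1), f s t := by
  rw [Finset.sum_sigma', Finset.sum_sigma']
  refine Finset.sum_bij' (fun p _ => ⟨p.2, p.1 - p.2⟩) (fun p _ => ⟨p.1 + p.2, p.1⟩) ?_ ?_ ?_ ?_ ?_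
  · rintro ⟨n, s⟩ h
    simp only [Finset.mem_sigma, Finset.mem_range] at h ⊢
    omega
  · rintro ⟨n, s⟩ h
    simp only [Finset.mem_sigma, Finset.mem_range] at h ⊢
    omega
  · rintro ⟨n, s⟩ h
    simp only [Finset.mem_sigma, Finset.mem_range] at h
    simp only [Sigma.mk.injEq, heq_eq_eq, and_true]
    omega
  · rintro ⟨n, s⟩ h
    simp
  · rintro ⟨n, s⟩ h
    rfl

lemma sum_forestCoeff_le {g : ℕ → ℝ≥0∞} {r Ψ : ℝ≥0∞}
    (h : ∑' n, g n * (r * Ψ) ^ n ≤ Ψ) (ℓ N : ℕ) :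
    ∑ n ∈ Finset.range (N + 1), r ^ n * forestCoeff g ℓ n ≤ Ψ ^ ℓ := by
  induction N using Nat.strong_induction_on generalizing ℓ with
  | _ N ihN =>
    induction ℓ with
    | zero =>
      rw [Finset.sum_eq_single 0] <;> simp +contextual [forestCoeff_zero]
    | succ ℓ ihℓ =>
      have key : ∀ s ∈ Finset.range (N + 1),
          ∑ t ∈ Finset.range (N - s + 1), r ^ t * forestCoeff g (s + ℓ) t ≤ Ψ ^ (s + ℓ) := by
        intro s hs
        rcases Nat.eq_zero_or_pos s with rfl | h0
        · simpa using ihℓ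
        · exact ihN (N - s) (by have := Finset.mem_range.1 hs; omega) _
      calc ∑ n ∈ Finset.range (N + 1), r ^ n * forestCoeff g (ℓ + 1) n
          = ∑ n ∈ Finset.range (N + 1), ∑ s ∈ Finset.range (n + 1),
              (r ^ s * g s) * (r ^ (n - s) * forestCoeff g (s + ℓ) (n - s)) := by
            refine Finset.sum_congr rfl fun n _ => ?_
            rw [forestCoeff_succ, Finset.mul_sum]
            refine Finset.sum_congr rfl fun s hs => ?_
            have : r ^ n = r ^ s * r ^ (n - s) := by
              rw [← pow_add]; congr 1; have := Finset.mem_range.1 hs; omega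
            rw [this]; ring
        _ = ∑ s ∈ Finset.range (N + 1), (r ^ s * g s) *
              ∑ t ∈ Finset.range (N - s + 1), r ^ t * forestCoeff g (s + ℓ) t := by
            rw [sum_range_triangle fun s t => (r ^ s * g s) * (r ^ t * forestCoeff g (s + ℓ) t)]
            simp_rw [Finset.mul_sum]
        _ ≤ ∑ s ∈ Finset.range (N + 1), (r ^ s * g s) * Ψ ^ (s + ℓ) :=
            Finset.sum_le_sum fun s hs => mul_le_mul_right (key s hs) _
        _ = (∑ s ∈ Finset.range (N + 1), g s * (r * Ψ) ^ s) * Ψ ^ ℓ := by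
            rw [Finset.sum_mul]
            exact Finset.sum_congr rfl fun s _ => by rw [mul_pow, pow_add]; ring
        _ ≤ Ψ * Ψ ^ ℓ := mul_le_mul_left ((ENNReal.sum_le_tsum _).trans h) _
        _ = Ψ ^ (ℓ + 1) := by ring

lemma choose_mul_factorial_eq {n s : ℕ} (h : s ≤ n) (a b : ℝ≥0∞) :
    (n.choose s : ℝ≥0∞) * (a * ((n - s).factorial * b)) =
      n.factorial * (a / s.factorial * b) := by
  have : (n.factorial : ℝ≥0∞) = n.choose s * s.factorial * (n - s).factorial := by
    exact_mod_cast (Nat.choose_mul_factorial_mul_factorial h).symm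
  have h0 : (s.factorial : ℝ≥0∞) ≠ 0 := by exact_mod_cast s.factorial_ne_zero
  rw [this, ENNReal.div_eq_inv_mul]
  calc _ = (s.factorial * (s.factorial : ℝ≥0∞)⁻¹) *
        ((n.choose s : ℝ≥0∞) * (a * ((n - s).factorial * b))) := by
        rw [ENNReal.mul_inv_cancel h0 (ENNReal.natCast_ne_top _), one_mul]
    _ = _ := by ring

variable {d : ℕ} {w : (Fin d → ℝ) → (Fin d → ℝ) → ℝ} (hw : IsRepulsive w)
include hw

lemma lmarginal_ratioCoeff_le (L : List ℕ) (X : Finset ℕ) (hL : ∀ x ∈ L, x ∉ X)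
    (p : ℕ → Fin d → ℝ) :
    lmarginal (fun _ => volume) X
      (fun p => ENNReal.ofReal (ratioCoeff (edgeW w hw.symm p) (fun _ => 1) L X)) p ≤
      X.card.factorial * forestCoeff (fun n => vertexInt w n / n.factorial) L.length X.card := by
  induction L, X using ratio_induction generalizing p with
  | nil X =>
    rcases X.eq_empty_or_nonempty with rfl | hX
    · simp [ratioCoeff_nil, forestCoeff_zero]
    · simp [ratioCoeff_nil, forestCoeff_zero, hX.ne_empty, lmarginal]
  | cons y L X ih =>
    have hyX : y ∉ X := hL y List.mem_cons_self
    have hLX : ∀ x ∈ L, x ∉ X := fun x hx => hL x (List.mem_cons_of_mem _ hx)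
    have hr := fun p (L : List ℕ) (Y : Finset ℕ) => ratioCoeff_nonneg (edgeW_nonneg hw p)
      (edgeW_le_one hw p) (u := fun _ => 1) (fun _ => zero_le_one) L Y
    have hv := fun p (y : ℕ) (Y : Finset ℕ) => vertexW_nonneg (edgeW_nonneg hw p)
      (edgeW_le_one hw p) y Y
    have mr : ∀ (L : List ℕ) (Y : Finset ℕ), Measurable fun p : ℕ → Fin d → ℝ =>
        ENNReal.ofReal (ratioCoeff (edgeW w hw.symm p) (fun _ => 1) L Y) := fun L Y =>
      (measurable_ratioCoeff hw (fun _ => measurable_const) L Y).ennreal_ofReal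
    have mv : ∀ (Y : Finset ℕ), Measurable fun p : ℕ → Fin d → ℝ =>
        ENNReal.ofReal (vertexW (edgeW w hw.symm p) y Y) := fun Y =>
      (measurable_vertexW hw y Y).ennreal_ofReal
    have step1 : ∀ p : ℕ → Fin d → ℝ,
        ENNReal.ofReal (ratioCoeff (edgeW w hw.symm p) (fun _ => 1) (y :: L) X) ≤
          ∑ S ∈ X.powerset, ENNReal.ofReal (vertexW (edgeW w hw.symm p) y S) *
            ENNReal.ofReal (ratioCoeff (edgeW w hw.symm p) (fun _ => 1)
              (S.toList ++ L) (X \ S)) := by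
      intro p
      rw [ratioCoeff_cons, ENNReal.ofReal_sum_of_nonneg]
      · refine Finset.sum_le_sum fun S _ => ?_
        rw [← ENNReal.ofReal_mul (hv p y S)]
        refine ENNReal.ofReal_le_ofReal (mul_le_mul_of_nonneg_right ?_ (hr p _ _))
        refine mul_le_of_le_one_right (hv p y S) (Finset.prod_le_one ?_ ?_)
        · exact fun s _ => mul_nonneg zero_le_one (listW_nonneg (edgeW_nonneg hw p) _ _)
        · intro s _
          rw [one_mul]
          exact listW_le_one (edgeW_nonneg hw p) (edgeW_le_one hw p) _ _
      · intro S _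
        refine mul_nonneg (mul_nonneg (hv p y S) (Finset.prod_nonneg fun s _ =>
          mul_nonneg zero_le_one (listW_nonneg (edgeW_nonneg hw p) _ _))) (hr p _ _)
    refine (lmarginal_mono step1 p).trans ?_
    have mp : ∀ S : Finset ℕ, Measurable fun p : ℕ → Fin d → ℝ =>
        ENNReal.ofReal (vertexW (edgeW w hw.symm p) y S) *
          ENNReal.ofReal (ratioCoeff (edgeW w hw.symm p) (fun _ => 1) (S.toList ++ L) (X \ S)) :=
      fun S => (mv S).mul (mr _ _)
    refine (lmarginal_sum X.powerset _ (fun S _ => mp S) p).trans_le ?_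
    have step2 : ∀ S ∈ X.powerset, lmarginal (fun _ => volume) X (fun p : ℕ → Fin d → ℝ =>
        ENNReal.ofReal (vertexW (edgeW w hw.symm p) y S) *
            ENNReal.ofReal (ratioCoeff (edgeW w hw.symm p) (fun _ => 1)
              (S.toList ++ L) (X \ S))) p ≤ vertexInt w S.card *
          ((X.card - S.card).factorial * forestCoeff (fun n => vertexInt w n / n.factorial)
            (S.card + L.length) (X.card - S.card)) := by
      intro S hS
      have hS := Finset.mem_powerset.1 hS
      have hyS : y ∉ S := fun h => hyX (hS h)
      rw [lmarginal_sdiff hS (mp S), ← lmarginal_vertexW hw hyS p]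
      have : ∀ q : ℕ → Fin d → ℝ, lmarginal (fun _ => volume) (X \ S) (fun p : ℕ → Fin d → ℝ =>
          ENNReal.ofReal (vertexW (edgeW w hw.symm p) y S) *
            ENNReal.ofReal (ratioCoeff (edgeW w hw.symm p) (fun _ => 1)
              (S.toList ++ L) (X \ S))) q ≤
          ((X.card - S.card).factorial * forestCoeff (fun n => vertexInt w n / n.factorial)
            (S.card + L.length) (X.card - S.card)) *
            ENNReal.ofReal (vertexW (edgeW w hw.symm q) y S) := by
        intro q
        rw [lmarginal_mul_left (mr _ _), mul_comm]
        · refine mul_le_mul_left ?_ _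
          have := ih S hS (fun x hx => ?_) q
          · simpa [Finset.card_sdiff_of_subset hS] using this
          · rcases List.mem_append.1 hx with hx | hx
            · have := Finset.mem_toList.1 hx
              simp [this]
            · exact fun h => hLX x hx (Finset.sdiff_subset h)
        · intro q' hq'
          have hSq : ∀ x ∈ insert y S, q' x = q x := by
            intro x hx
            refine hq' x ?_
            rcases Finset.mem_insert.1 hx with rfl | hx
            · exact fun h => hyX (Finset.sdiff_subset h)
            · simp [hx]
          congr 1
          refine vertexW_congr fun x hx z hz => ?_
          rw [edgeW_mk, edgeW_mk, hSq x hx, hSq z (Finset.mem_insert_of_mem hz)]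
      refine (lmarginal_mono this p).trans ?_
      rw [lmarginal_mul_left (c := fun _ => _) (mv S) (fun _ _ => rfl), mul_comm]
    refine (Finset.sum_le_sum step2).trans ?_
    rw [Finset.sum_powerset_apply_card fun s => vertexInt w s *
          ((X.card - s).factorial * forestCoeff (fun n => vertexInt w n / n.factorial)
            (s + L.length) (X.card - s)), List.length_cons, forestCoeff_succ, Finset.mul_sum]
    refine (Finset.sum_congr rfl fun s hs => ?_).le
    rw [nsmul_eq_mul, choose_mul_factorial_eq (by have := Finset.mem_range.1 hs; omega)]

lemma clusterInt_le (n : ℕ) : clusterInt w n ≤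
    n.factorial * forestCoeff (fun n => vertexInt w n / n.factorial) 1 n := by
  have := lmarginal_ratioCoeff_le hw [n] (Finset.range n) (by simp) 0
  rwa [lmarginal_ratioCoeff_singleton hw (by simp), Finset.card_range] at this

/-- Convergence of the rooted cluster expansion up to `μ / Ψ(μ)`. -/
lemma sum_clusterInt_le {r Ψ : ℝ≥0∞}
    (h : ∑' n, vertexInt w n / n.factorial * (r * Ψ) ^ n ≤ Ψ) (N : ℕ) :
    ∑ n ∈ Finset.range (N + 1), clusterInt w n / n.factorial * r ^ n ≤ Ψ := by
  refine le_trans (Finset.sum_le_sum fun n _ => ?_) ((sum_forestCoeff_le h 1 N).trans (by simp))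
  rw [mul_comm]
  refine mul_le_mul_right (ENNReal.div_le_of_le_mul ?_) _
  rw [mul_comm]
  exact clusterInt_le hw n

end ForestBound

section Renewal

/-- The part of the recursion for one root that does not involve the descendants of the last
child. -/
def lastChildW {V : Type*} [DecidableEq V] (W : Sym2 V → ℝ) (y : V) (S R : Finset V) : ℝ :=
  if h : S.toList = [] then 0 else
    vertexW W y S * ratioCoeff W (fun x => W s(S.toList.getLast h, x)) S.toList.dropLast R

lemma lastChildW_congr {V : Type*} [DecidableEq V] {W W' : Sym2 V → ℝ} {y : V} {S R : Finset V}
    (h : ∀ x ∈ insert y (S ∪ R), ∀ z ∈ S ∪ R, W s(x, z) = W' s(x, z)) :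
    lastChildW W y S R = lastChildW W' y S R := by
  unfold lastChildW
  split_ifs with h0
  · rfl
  · have hmem : ∀ x ∈ S.toList, x ∈ S := fun x hx => Finset.mem_toList.1 hx
    congr 1
    · refine vertexW_congr fun x hx z hz => h x ?_ z (Finset.mem_union_left _ hz)
      grind
    · refine ratioCoeff_congr _ _ (fun x hx z hz => h x ?_ z (Finset.mem_union_right _ hz))
        fun x hx => h _ ?_ x (Finset.mem_union_right _ hx)
      · rcases hx with hx | hx
        · have := hmem x (List.mem_of_mem_dropLast hx)
          grind
        · grind
      · have := hmem _ (List.getLast_mem h0)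
        grind

lemma lastChildW_empty {V : Type*} [DecidableEq V] (W : Sym2 V → ℝ) (y : V) (R : Finset V) :
    lastChildW W y ∅ R = 0 := by
  simp [lastChildW]

lemma lastChildW_nonneg {V : Type*} [DecidableEq V] {W : Sym2 V → ℝ} (hW : ∀ e, 0 ≤ W e)
    (hW1 : ∀ e, W e ≤ 1) (y : V) (S R : Finset V) : 0 ≤ lastChildW W y S R := by
  unfold lastChildW
  split_ifs with h0
  · exact le_rfl
  · exact mul_nonneg (vertexW_nonneg hW hW1 _ _) (ratioCoeff_nonneg hW hW1 (fun _ => hW _) _ _)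

/-- The last child of a vertex, if the children are `S`. -/
def lastChild (S : Finset ℕ) : ℕ := S.toList.getLastD 0

lemma lastChild_mem {S : Finset ℕ} (hS : S.Nonempty) : lastChild S ∈ S := by
  have h : S.toList ≠ [] := by simpa using hS.ne_empty
  rw [lastChild, List.getLastD_eq_getLast?, List.getLast?_eq_some_getLast h]
  exact Finset.mem_toList.1 (List.getLast_mem h)

lemma ratioCoeff_singleton_eq_sum (W : Sym2 ℕ → ℝ) (y : ℕ) {X : Finset ℕ} (hX : X.Nonempty) :
    ratioCoeff W (fun _ => 1) [y] X = ∑ S ∈ X.powerset, ∑ T ∈ (X \ S).powerset,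
      lastChildW W y S ((X \ S) \ T) * ratioCoeff W (fun _ => 1) [lastChild S] T := by
  rw [ratioCoeff_cons]
  refine Finset.sum_congr rfl fun S hS => ?_
  rcases S.eq_empty_or_nonempty with rfl | hne
  · simp [lastChildW_empty, ratioCoeff_nil, hX.ne_empty]
  · have h : S.toList ≠ [] := by simpa using hne.ne_empty
    have h1 : S.toList = S.toList.dropLast ++ [S.toList.getLast h] :=
      (List.dropLast_append_getLast h).symm
    have h2 : lastChild S = S.toList.getLast h := by
      rw [lastChild, List.getLastD_eq_getLast?, List.getLast?_eq_some_getLast h]; rfl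
    simp only [listW_nil, mul_one, Finset.prod_const_one, List.append_nil]
    conv_lhs => rw [h1, ratioCoeff_append_singleton]
    rw [Finset.mul_sum]
    refine Finset.sum_congr rfl fun T _ => ?_
    rw [lastChildW, dif_neg h, h2]
    ring

variable {d : ℕ} {w : (Fin d → ℝ) → (Fin d → ℝ) → ℝ} (hw : IsRepulsive w)

/-- Integrated version of `lastChildW`. -/
def lastChildInt (hw : IsRepulsive w) (R : Finset ℕ) : ℝ≥0∞ :=
  ∑ S ∈ R.powerset, lmarginal (fun _ => volume) R
    (fun p => ENNReal.ofReal (lastChildW (edgeW w hw.symm p) 0 S (R \ S))) 0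

include hw

lemma measurable_lastChildW (y : ℕ) (S R : Finset ℕ) :
    Measurable fun p : ℕ → Fin d → ℝ => lastChildW (edgeW w hw.symm p) y S R := by
  by_cases h : S.toList = []
  · simp only [lastChildW, h, dite_true]
    exact measurable_const
  · simp only [lastChildW, h, dite_false]
    exact (measurable_vertexW hw y S).mul
      (measurable_ratioCoeff hw (fun x => measurable_edgeW hw _) _ _)

lemma clusterInt_zero : clusterInt w 0 = 1 := by
  have := lmarginal_ratioCoeff_singleton hw (y := 0) (X := ∅) (by simp) 0
  rw [Finset.card_empty] at this
  rw [← this, lmarginal_empty]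
  simp [ratioCoeff_cons, ratioCoeff_nil, vertexW]

lemma lmarginal_lastChildW_mul {X S T : Finset ℕ} (h0 : 0 ∉ X) (hT : T ⊆ X) (hS : S ⊆ X \ T) :
    lmarginal (fun _ => volume) X (fun p => ENNReal.ofReal
      (lastChildW (edgeW w hw.symm p) 0 S ((X \ T) \ S) *
        ratioCoeff (edgeW w hw.symm p) (fun _ => 1) [lastChild S] T)) 0 =
      clusterInt w T.card * lmarginal (fun _ => volume) (X \ T)
        (fun p => ENNReal.ofReal (lastChildW (edgeW w hw.symm p) 0 S ((X \ T) \ S))) 0 := by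
  rcases S.eq_empty_or_nonempty with rfl | hne
  · simp [lastChildW_empty, lmarginal]
  have mr : Measurable fun p : ℕ → Fin d → ℝ =>
        ENNReal.ofReal (ratioCoeff (edgeW w hw.symm p) (fun _ => 1) [lastChild S] T) :=
    (measurable_ratioCoeff hw (fun _ => measurable_const) _ T).ennreal_ofReal
  have mc : Measurable fun p : ℕ → Fin d → ℝ =>
        ENNReal.ofReal (lastChildW (edgeW w hw.symm p) 0 S ((X \ T) \ S)) :=
    (measurable_lastChildW hw _ _ _).ennreal_ofReal
  have hmul : ∀ p : ℕ → Fin d → ℝ, ENNReal.ofReal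
      (lastChildW (edgeW w hw.symm p) 0 S ((X \ T) \ S) *
        ratioCoeff (edgeW w hw.symm p) (fun _ => 1) [lastChild S] T) =
      ENNReal.ofReal (lastChildW (edgeW w hw.symm p) 0 S ((X \ T) \ S)) *
        ENNReal.ofReal (ratioCoeff (edgeW w hw.symm p) (fun _ => 1) [lastChild S] T) :=
    fun p => ENNReal.ofReal_mul
      (lastChildW_nonneg (edgeW_nonneg hw p) (edgeW_le_one hw p) _ _ _)
  have mm : Measurable fun p : ℕ → Fin d → ℝ =>
      ENNReal.ofReal (lastChildW (edgeW w hw.symm p) 0 S ((X \ T) \ S)) *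
        ENNReal.ofReal (ratioCoeff (edgeW w hw.symm p) (fun _ => 1) [lastChild S] T) := mc.mul mr
  simp only [hmul]
  rw [lmarginal_sdiff (Finset.sdiff_subset (s := X) (t := T)) mm, Finset.sdiff_sdiff_eq_self hT]
  have inner : ∀ q : ℕ → Fin d → ℝ, lmarginal (fun _ => volume) T (fun p =>
      ENNReal.ofReal (lastChildW (edgeW w hw.symm p) 0 S ((X \ T) \ S)) *
        ENNReal.ofReal (ratioCoeff (edgeW w hw.symm p) (fun _ => 1) [lastChild S] T)) q =
      clusterInt w T.card *
        ENNReal.ofReal (lastChildW (edgeW w hw.symm q) 0 S ((X \ T) \ S)) := by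
    intro q
    rw [lmarginal_mul_left mr, lmarginal_ratioCoeff_singleton hw, mul_comm]
    · intro h
      exact (Finset.mem_sdiff.1 (hS (lastChild_mem hne))).2 h
    · intro q' hq'
      have hTq : ∀ x ∈ insert 0 (S ∪ (X \ T) \ S), q' x = q x := by
        intro x hx
        rw [Finset.union_sdiff_of_subset hS] at hx
        refine hq' x fun hxT => ?_
        rcases Finset.mem_insert.1 hx with rfl | hx
        · exact h0 (hT hxT)
        · exact (Finset.mem_sdiff.1 hx).2 hxT
      congr 1
      refine lastChildW_congr fun x hx z hz => ?_
      rw [edgeW_mk, edgeW_mk, hTq x hx, hTq z (Finset.mem_insert_of_mem hz)]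
  rw [funext inner, lmarginal_mul_left (c := fun _ => _) mc fun _ _ => rfl]

lemma clusterInt_renewal {X : Finset ℕ} (h0 : 0 ∉ X) (hX : X.Nonempty) :
    clusterInt w X.card = ∑ T ∈ X.powerset, clusterInt w T.card * lastChildInt hw (X \ T) := by
  rw [← lmarginal_ratioCoeff_singleton hw h0 0]
  have hn := fun p S R => lastChildW_nonneg (edgeW_nonneg hw p) (edgeW_le_one hw p) 0 S R
  have hr := fun p (L : List ℕ) (Y : Finset ℕ) => ratioCoeff_nonneg (edgeW_nonneg hw p)
      (edgeW_le_one hw p) (u := fun _ => 1) (fun _ => zero_le_one) L Y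
  have hm : ∀ S T : Finset ℕ, Measurable fun p : ℕ → Fin d → ℝ => ENNReal.ofReal
      (lastChildW (edgeW w hw.symm p) 0 S ((X \ T) \ S) *
        ratioCoeff (edgeW w hw.symm p) (fun _ => 1) [lastChild S] T) := fun S T =>
    ((measurable_lastChildW hw _ _ _).mul
      (measurable_ratioCoeff hw (fun _ => measurable_const) _ T)).ennreal_ofReal
  have e1 : ∀ p : ℕ → Fin d → ℝ,
      ENNReal.ofReal (ratioCoeff (edgeW w hw.symm p) (fun _ => 1) [0] X) =
      ∑ T ∈ X.powerset, ∑ S ∈ (X \ T).powerset, ENNReal.ofReal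
        (lastChildW (edgeW w hw.symm p) 0 S ((X \ T) \ S) *
          ratioCoeff (edgeW w hw.symm p) (fun _ => 1) [lastChild S] T) := by
    intro p
    rw [ratioCoeff_singleton_eq_sum _ _ hX, sum_disjoint_pairs_comm X fun S T R =>
      lastChildW (edgeW w hw.symm p) 0 S R *
        ratioCoeff (edgeW w hw.symm p) (fun _ => 1) [lastChild S] T,
      ENNReal.ofReal_sum_of_nonneg]
    · refine Finset.sum_congr rfl fun T _ => ENNReal.ofReal_sum_of_nonneg fun S _ => ?_
      exact mul_nonneg (hn _ _ _) (hr _ _ _)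
    · exact fun T _ => Finset.sum_nonneg fun S _ => mul_nonneg (hn _ _ _) (hr _ _ _)
  simp only [e1]
  rw [lmarginal_sum X.powerset _ fun T _ => Finset.measurable_sum _ fun S _ => hm S T]
  refine Finset.sum_congr rfl fun T hT => ?_
  rw [lmarginal_sum _ _ fun S _ => hm S T, lastChildInt, Finset.mul_sum]
  refine Finset.sum_congr rfl fun S hS => ?_
  exact lmarginal_lastChildW_mul hw h0 (Finset.mem_powerset.1 hT) (Finset.mem_powerset.1 hS)

lemma lastChildInt_empty : lastChildInt hw ∅ = 0 := by
  simp [lastChildInt, lastChildW_empty]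

omit hw in
/-- A set function solving a renewal equation is given by a formal power series. -/
lemma eq_coeff_of_renewal (a : ℕ → ℝ) (ha : a 0 = 1) (k : Finset ℕ → ℝ)
    (hk : ∀ X : Finset ℕ, 0 ∉ X → ∑ T ∈ X.powerset, a T.card * k (X \ T) =
      if X = ∅ then 0 else a X.card) (X : Finset ℕ) (hX : 0 ∉ X) :
    k X = X.card.factorial *
      PowerSeries.coeff X.card (1 - (PowerSeries.mk fun n => a n / n.factorial)⁻¹) := by
  set F : PowerSeries ℝ := PowerSeries.mk fun n => a n / n.factorial with hF
  have hF0 : PowerSeries.constantCoeff F ≠ 0 := by simp [hF, ha]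
  have hFC : F * (1 - F⁻¹) = F - 1 := by rw [mul_sub, PowerSeries.mul_inv_cancel F hF0, mul_one]
  set C := 1 - F⁻¹
  have hconv : ∀ Y : Finset ℕ, ∑ T ∈ Y.powerset,
      a T.card * ((Y \ T).card.factorial * PowerSeries.coeff (Y \ T).card C) =
      if Y = ∅ then 0 else a Y.card := by
    intro Y
    have h1 : ∑ T ∈ Y.powerset,
        a T.card * ((Y \ T).card.factorial * PowerSeries.coeff (Y \ T).card C) =
        ∑ T ∈ Y.powerset,
          (fun m => a m * ((Y.card - m).factorial * PowerSeries.coeff (Y.card - m) C)) T.card :=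
      Finset.sum_congr rfl fun T hT => by
        rw [Finset.card_sdiff_of_subset (Finset.mem_powerset.1 hT)]
    rw [h1, Finset.sum_powerset_apply_card fun m =>
      a m * ((Y.card - m).factorial * PowerSeries.coeff (Y.card - m) C)]
    have h2 := congrArg (PowerSeries.coeff Y.card) hFC
    rw [PowerSeries.coeff_mul, Finset.Nat.sum_antidiagonal_eq_sum_range_succ_mk] at h2
    have h3 : ∑ m ∈ Finset.range (Y.card + 1), Y.card.choose m •
        (a m * ((Y.card - m).factorial * PowerSeries.coeff (Y.card - m) C)) =
        Y.card.factorial * PowerSeries.coeff Y.card (F - 1) := by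
      rw [← h2, Finset.mul_sum]
      refine Finset.sum_congr rfl fun m hm => ?_
      have hm : m ≤ Y.card := by have := Finset.mem_range.1 hm; omega
      have := Nat.choose_mul_factorial_mul_factorial hm
      have : (Y.card.factorial : ℝ) = Y.card.choose m * m.factorial * (Y.card - m).factorial := by
        exact_mod_cast this.symm
      have hm0 : (m.factorial : ℝ) ≠ 0 := by exact_mod_cast m.factorial_ne_zero
      rw [this, hF, PowerSeries.coeff_mk, nsmul_eq_mul]
      field_simp
    rw [h3, hF, map_sub, PowerSeries.coeff_mk, PowerSeries.coeff_one]
    have hY0 : (Y.card.factorial : ℝ) ≠ 0 := by exact_mod_cast Y.card.factorial_ne_zero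
    split_ifs with h4 h5 h5
    · simp [h4, ha]
    · exact absurd (Finset.card_eq_zero.1 h4) h5
    · exact absurd (by simp [h5]) h4
    · field_simp
      ring
  induction X using Finset.strongInduction with
  | _ X ih =>
    have e := (hk X hX).trans (hconv X).symm
    rw [← Finset.sum_erase_add _ _ (Finset.empty_mem_powerset X),
      ← Finset.sum_erase_add _ _ (Finset.empty_mem_powerset X)] at e
    have e2 : ∀ T ∈ X.powerset.erase ∅, a T.card * k (X \ T) =
        a T.card * ((X \ T).card.factorial * PowerSeries.coeff (X \ T).card C) := by
      intro T hT
      simp only [Finset.mem_erase, Finset.mem_powerset] at hT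
      rw [ih (X \ T) (Finset.sdiff_ssubset hT.2 (Finset.nonempty_iff_ne_empty.2 hT.1))
        fun h => hX (Finset.sdiff_subset h)]
    rw [Finset.sum_congr rfl e2] at e
    simpa [ha] using add_left_cancel e

/-- The cluster series, with alternating signs removed. -/
def clusterSeries (w : (Fin d → ℝ) → (Fin d → ℝ) → ℝ) : PowerSeries ℝ :=
  PowerSeries.mk fun n => (clusterInt w n).toReal / n.factorial

lemma coeff_one_sub_inv_clusterSeries_nonneg (hfin : ∀ n, clusterInt w n ≠ ∞) (n : ℕ) :
    0 ≤ PowerSeries.coeff n (1 - (clusterSeries w)⁻¹) := by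
  have hk : ∀ X : Finset ℕ, 0 ∉ X → lastChildInt hw X ≠ ∞ := by
    intro X hX
    rcases X.eq_empty_or_nonempty with rfl | hne
    · simp [lastChildInt_empty hw]
    · refine ne_top_of_le_ne_top (hfin X.card) ?_
      rw [clusterInt_renewal hw hX hne]
      refine le_trans ?_ (Finset.single_le_sum (f := fun T =>
        clusterInt w T.card * lastChildInt hw (X \ T)) (fun _ _ => zero_le)
        (Finset.empty_mem_powerset X))
      simp [clusterInt_zero hw]
  have key := eq_coeff_of_renewal (fun n => (clusterInt w n).toReal) (by simp [clusterInt_zero hw])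
    (fun X => (lastChildInt hw X).toReal) (fun X hX => ?_) ((Finset.range n).map (addRightEmbedding 1))
    (by simp)
  · rw [Finset.card_map, Finset.card_range] at key
    have hn : (0 : ℝ) < n.factorial := by exact_mod_cast n.factorial_pos
    refine nonneg_of_mul_nonneg_right ?_ hn
    rw [clusterSeries, ← key]
    exact ENNReal.toReal_nonneg
  · split_ifs with h
    · simp [h, lastChildInt_empty hw]
    · rw [clusterInt_renewal hw hX (Finset.nonempty_iff_ne_empty.2 h), ENNReal.toReal_sum]
      · simp only [ENNReal.toReal_mul]
      · exact fun T _ => ENNReal.mul_ne_top (hfin _) (hk _ fun h => hX (Finset.sdiff_subset h))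

end Renewal

section FormalSeries

open PowerSeries in
lemma factorial_mul_bellPoly (y : ℕ → ℝ) (hy : y 0 = 1) {n k : ℕ} (hk : 1 ≤ k) (hkn : k ≤ n) :
    k.factorial * BellPoly n k y =
      n.factorial * coeff n ((mk (fun i => y i / i.factorial) - 1) ^ k) := by
  set f : PowerSeries ℝ := mk fun i => y i / i.factorial with hf
  let t : Fin (n - k + 1) → PowerSeries ℝ := fun i =>
    C (y (i.1 + 1) / ((i.1 + 1).factorial : ℝ)) * X ^ (i.1 + 1)
  set P : PowerSeries ℝ := ∑ i, t i with hP
  have hXP : X ∣ P := Finset.dvd_sum fun i _ => Dvd.dvd.mul_left (dvd_pow_self _ (by omega)) _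
  have hXf : X ∣ f - 1 := by
    rw [X_dvd_iff]
    simp [hf, hy]
  have hfP : X ^ (n - k + 2) ∣ f - 1 - P := by
    rw [X_pow_dvd_iff]
    intro m hm
    rw [map_sub, map_sub, hP, map_sum]
    simp only [t, coeff_C_mul, coeff_X_pow, hf, coeff_mk, coeff_one]
    rcases Nat.eq_zero_or_pos m with rfl | hm0
    · simp [hy]
    · rw [Finset.sum_eq_single (⟨m - 1, by omega⟩ : Fin (n - k + 1))]
      · have : m - 1 + 1 = m := by omega
        simp [this, hm0.ne']
      · intro i _ hi
        rw [if_neg, mul_zero]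
        intro h
        exact hi (Fin.ext (by simp only; omega))
      · simp
  have hpow : X ^ (n + 1) ∣ (f - 1) ^ k - P ^ k := by
    rw [← geom_sum₂_mul, show n + 1 = (k - 1) + (n - k + 2) by omega, pow_add]
    refine mul_dvd_mul (Finset.dvd_sum fun i hi => ?_) hfP
    have hi := Finset.mem_range.1 hi
    rw [show k - 1 = i + (k - 1 - i) by omega, pow_add,
      show i + (k - 1 - i) - i = k - 1 - i by omega]
    exact mul_dvd_mul (pow_dvd_pow_of_dvd hXf _) (pow_dvd_pow_of_dvd hXP _)
  have hcoeff : coeff n ((f - 1) ^ k) = coeff n (P ^ k) := by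
    have := X_pow_dvd_iff.1 hpow n (by omega)
    rwa [map_sub, sub_eq_zero] at this
  have hprod : ∀ α : Fin (n - k + 1) → ℕ, coeff n (∏ i, t i ^ α i) =
      if ∑ i : Fin (n - k + 1), (i.1 + 1) * α i = n then
        ∏ i : Fin (n - k + 1), (y (i.1 + 1) / ((i.1 + 1).factorial : ℝ)) ^ (α i) else 0 := by
    intro α
    have : ∏ i, t i ^ α i =
        C (∏ i : Fin (n - k + 1), (y (i.1 + 1) / ((i.1 + 1).factorial : ℝ)) ^ (α i)) *
          X ^ (∑ i : Fin (n - k + 1), (i.1 + 1) * α i) := by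
      simp only [t, mul_pow, Finset.prod_mul_distrib, map_prod, map_pow, ← pow_mul,
        Finset.prod_pow_eq_pow_sum]
    rw [this, coeff_C_mul, coeff_X_pow]
    simp [eq_comm]
  rw [hcoeff, hP, Finset.sum_pow_eq_sum_piAntidiag, map_sum, BellPoly, Finset.mul_sum,
    Finset.mul_sum]
  have hset : ((Fintype.piFinset fun _ : Fin (n - k + 1) => Finset.range (n + 1)).filter
      (fun α : Fin (n - k + 1) → ℕ =>
        (∑ i, α i) = k ∧ (∑ i : Fin (n - k + 1), (i.1 + 1) * α i) = n)) =
      (Finset.univ.piAntidiag k).filter fun α : Fin (n - k + 1) → ℕ =>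
        (∑ i : Fin (n - k + 1), (i.1 + 1) * α i) = n := by
    ext α
    simp only [Finset.mem_filter, Fintype.mem_piFinset, Finset.mem_range, Finset.mem_piAntidiag,
      Finset.mem_univ, implies_true, and_true]
    constructor
    · rintro ⟨-, h1, h2⟩
      exact ⟨h1, h2⟩
    · rintro ⟨h1, h2⟩
      refine ⟨fun i => ?_, h1, h2⟩
      have := (Finset.single_le_sum (f := α) (fun _ _ => Nat.zero_le _)
        (Finset.mem_univ i)).trans_eq h1
      omega
  rw [hset, Finset.sum_filter]
  refine Finset.sum_congr rfl fun α hα => ?_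
  have hα : ∑ i, α i = k := (Finset.mem_piAntidiag.1 hα).1
  have hmul : (k.factorial : ℝ) = (∏ i, ((α i).factorial : ℝ)) * Nat.multinomial Finset.univ α := by
    have e := Nat.multinomial_spec Finset.univ α
    rw [hα] at e
    exact_mod_cast e.symm
  have hne : (∏ i, ((α i).factorial : ℝ)) ≠ 0 :=
    Finset.prod_ne_zero_iff.2 fun i _ => by exact_mod_cast (α i).factorial_ne_zero
  rw [← map_natCast (C (R := ℝ)), coeff_C_mul, hprod]
  split_ifs
  · rw [hmul]
    field_simp
  · simp

lemma genBinom_succ_add (x : ℝ) (k : ℕ) :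
    genBinom x (k + 1) + genBinom x k = genBinom (x + 1) (k + 1) := by
  have h : ∏ i ∈ Finset.range k, (x + 1 - (i + 1 : ℕ)) = ∏ i ∈ Finset.range k, (x - i) :=
    Finset.prod_congr rfl fun i _ => by push_cast; ring
  rw [genBinom, genBinom, genBinom, Finset.prod_range_succ, Finset.prod_range_succ', h,
    Nat.factorial_succ]
  have : (k.factorial : ℝ) ≠ 0 := by exact_mod_cast k.factorial_ne_zero
  push_cast
  field_simp
  ring

lemma genBinom_zero_succ (k : ℕ) : genBinom 0 (k + 1) = 0 := by
  simp [genBinom, Finset.prod_range_succ']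

open PowerSeries in
lemma one_add_mul_sum_genBinom (h : PowerSeries ℝ) (x : ℝ) (n : ℕ) :
    (1 + h) * ∑ k ∈ Finset.range (n + 1), C (genBinom x k) * h ^ k =
      ∑ k ∈ Finset.range (n + 1), C (genBinom (x + 1) k) * h ^ k +
        C (genBinom x n) * h ^ (n + 1) := by
  induction n with
  | zero => simp [genBinom]
  | succ n ih =>
    rw [Finset.sum_range_succ, mul_add, ih, Finset.sum_range_succ _ (n + 1), ← genBinom_succ_add,
      map_add]
    ring

open PowerSeries in
lemma X_pow_dvd_pow_mul_sum_genBinom {h : PowerSeries ℝ} (h0 : X ∣ h) (n m : ℕ) :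
    X ^ (n + 1) ∣
      (1 + h) ^ m * ∑ k ∈ Finset.range (n + 1), C (genBinom (-(m : ℝ)) k) * h ^ k - 1 := by
  induction m with
  | zero =>
    have h1 : ∀ k, genBinom (-((0 : ℕ) : ℝ)) (k + 1) = 0 := fun k => by
      rw [Nat.cast_zero, neg_zero, genBinom_zero_succ]
    have h2 : genBinom (-((0 : ℕ) : ℝ)) 0 = 1 := by simp [genBinom]
    rw [Finset.sum_range_succ']
    simp only [h1, h2]
    simp
  | succ m ih =>
    have e := one_add_mul_sum_genBinom h (-((m + 1 : ℕ) : ℝ)) n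
    rw [show -((m + 1 : ℕ) : ℝ) + 1 = -(m : ℝ) by push_cast; ring] at e
    rw [pow_succ (1 + h), mul_assoc, e, mul_add, add_sub_right_comm]
    refine dvd_add ih (Dvd.dvd.mul_left (Dvd.dvd.mul_left (pow_dvd_pow_of_dvd h0 _) _) _)

open PowerSeries in
/-- Lagrange inversion in terms of Bell polynomials. -/
lemma sum_genBinom_bellPoly (y : ℕ → ℝ) (hy : y 0 = 1) {n : ℕ} (hn : n ≠ 0) :
    ∑ k ∈ Finset.Icc 1 n, genBinom (-(n : ℝ)) k * (k.factorial : ℝ) * BellPoly n k y =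
      n.factorial * coeff n ((mk fun i => y i / i.factorial)⁻¹ ^ n) := by
  set f : PowerSeries ℝ := mk fun i => y i / i.factorial with hf
  have hX : X ∣ f - 1 := by
    rw [X_dvd_iff]
    simp [hf, hy]
  have hf0 : constantCoeff f ≠ 0 := by simp [hf, hy]
  have h1 := X_pow_dvd_pow_mul_sum_genBinom hX n n
  rw [add_sub_cancel] at h1
  have h2 : X ^ (n + 1) ∣
      ∑ k ∈ Finset.range (n + 1), C (genBinom (-(n : ℝ)) k) * (f - 1) ^ k - f⁻¹ ^ n := by
    have := Dvd.dvd.mul_left h1 (f⁻¹ ^ n)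
    rwa [mul_sub, ← mul_assoc, ← mul_pow, PowerSeries.inv_mul_cancel f hf0, one_pow, one_mul,
      mul_one] at this
  have h3 := X_pow_dvd_iff.1 h2 n (by omega)
  rw [map_sub, sub_eq_zero] at h3
  rw [← h3, map_sum, Finset.range_eq_Ico, Finset.sum_eq_sum_Ico_succ_bot (by omega), pow_zero,
    mul_one, coeff_C, if_neg hn, zero_add, Finset.mul_sum]
  refine Finset.sum_congr rfl fun k hk => ?_
  have hk := Finset.mem_Icc.1 hk
  rw [mul_assoc, factorial_mul_bellPoly y hy hk.1 hk.2, coeff_C_mul]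
  ring

open PowerSeries in
lemma abs_coeff_pow_le {A B : PowerSeries ℝ} (h : ∀ n, |coeff n A| ≤ coeff n B) (k n : ℕ) :
    |coeff n (A ^ k)| ≤ coeff n (B ^ k) := by
  induction k generalizing n with
  | zero => simp only [pow_zero, coeff_one]; split_ifs <;> simp
  | succ k ih =>
    rw [pow_succ, pow_succ, coeff_mul, coeff_mul]
    refine (Finset.abs_sum_le_sum_abs _ _).trans (Finset.sum_le_sum fun p _ => ?_)
    rw [abs_mul]
    exact mul_le_mul (ih _) (h _) (abs_nonneg _) ((abs_nonneg _).trans (ih _))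

/-- Partial sums of a power series. -/
def partialEval (r : ℝ) (N : ℕ) (A : PowerSeries ℝ) : ℝ :=
  ∑ m ∈ Finset.range (N + 1), PowerSeries.coeff m A * r ^ m

open PowerSeries in
lemma partialEval_mul (r : ℝ) (N : ℕ) (A B : PowerSeries ℝ) : partialEval r N (A * B) =
    ∑ s ∈ Finset.range (N + 1), coeff s A * r ^ s * partialEval r (N - s) B := by
  simp only [partialEval, Finset.mul_sum]
  rw [← sum_range_triangle fun s t => coeff s A * r ^ s * (coeff t B * r ^ t)]
  refine Finset.sum_congr rfl fun n _ => ?_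
  rw [coeff_mul, Finset.Nat.sum_antidiagonal_eq_sum_range_succ_mk, Finset.sum_mul]
  refine Finset.sum_congr rfl fun s hs => ?_
  have : r ^ n = r ^ s * r ^ (n - s) := by
    rw [← pow_add]; congr 1; have := Finset.mem_range.1 hs; omega
  rw [this]
  ring

open PowerSeries in
lemma partialEval_mono {r : ℝ} (hr : 0 ≤ r) {A : PowerSeries ℝ} (hA : ∀ n, 0 ≤ coeff n A) :
    Monotone fun N => partialEval r N A := fun _ _ h =>
  Finset.sum_le_sum_of_subset_of_nonneg (Finset.range_subset_range.2 (by omega)) fun _ _ _ =>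
    mul_nonneg (hA _) (pow_nonneg hr _)

open PowerSeries in
lemma partialEval_nonneg {r : ℝ} (hr : 0 ≤ r) {A : PowerSeries ℝ} (hA : ∀ n, 0 ≤ coeff n A)
    (N : ℕ) : 0 ≤ partialEval r N A :=
  Finset.sum_nonneg fun _ _ => mul_nonneg (hA _) (pow_nonneg hr _)

open PowerSeries in
lemma partialEval_pow_le {r : ℝ} (hr : 0 ≤ r) {A : PowerSeries ℝ} (hA : ∀ n, 0 ≤ coeff n A)
    (N k : ℕ) : partialEval r N (A ^ k) ≤ partialEval r N A ^ k := by
  induction k with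
  | zero =>
    rw [pow_zero, pow_zero, partialEval, Finset.sum_eq_single 0] <;>
      simp +contextual [coeff_one]
  | succ k ih =>
    rw [pow_succ', pow_succ', partialEval_mul, partialEval, Finset.sum_mul]
    have hAk : ∀ n, 0 ≤ coeff n (A ^ k) := fun n =>
      (abs_nonneg _).trans (abs_coeff_pow_le (A := A) (fun n => (abs_of_nonneg (hA n)).le) k n)
    refine Finset.sum_le_sum fun s _ => mul_le_mul_of_nonneg_left ?_
      (mul_nonneg (hA _) (pow_nonneg hr _))
    exact (partialEval_mono hr hAk (Nat.sub_le N s)).trans ih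

open PowerSeries Filter Topology in
/-- Bound on the coefficients of powers of the inverse of a renewal series. -/
lemma abs_coeff_inv_pow_le {F : PowerSeries ℝ} (hF : ∀ n, 0 ≤ coeff n F) (hF0 : coeff 0 F = 1)
    (hC : ∀ n, 0 ≤ coeff n (1 - F⁻¹)) {r Ψ : ℝ} (hr : 0 ≤ r)
    (hΨ : ∀ N, partialEval r N F ≤ Ψ) (n : ℕ) :
    |coeff n (F⁻¹ ^ n)| * r ^ n ≤ (2 - Ψ⁻¹) ^ n := by
  have hF0' : constantCoeff F ≠ 0 := by
    rw [← coeff_zero_eq_constantCoeff_apply, hF0]; exact one_ne_zero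
  have hCF : (1 - F⁻¹) * F = F - 1 := by rw [sub_mul, PowerSeries.inv_mul_cancel F hF0', one_mul]
  set c := 1 - F⁻¹ with hc
  have hsub : ∀ N, partialEval r N (F - 1) = partialEval r N F - 1 := by
    intro N
    simp only [partialEval, map_sub, sub_mul, Finset.sum_sub_distrib]
    congr 1
    rw [Finset.sum_eq_single 0] <;> simp +contextual [coeff_one]
  have hge1 : ∀ N, 1 ≤ partialEval r N F := fun N => by
    have := partialEval_mono hr hF (Nat.zero_le N)
    simpa [partialEval, ← coeff_zero_eq_constantCoeff_apply, hF0] using this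
  have hlim := tendsto_atTop_ciSup (partialEval_mono hr hF)
    ⟨Ψ, by rintro _ ⟨N, rfl⟩; exact hΨ N⟩
  set ℓ := ⨆ N, partialEval r N F
  have hℓ1 : 1 ≤ ℓ := ge_of_tendsto' hlim hge1
  have hℓΨ : ℓ ≤ Ψ := le_of_tendsto' hlim hΨ
  have hcn : partialEval r n c ≤ 1 - Ψ⁻¹ := by
    have h1 : ∀ M, partialEval r n c * partialEval r M F ≤ partialEval r (n + M) F - 1 := by
      intro M
      rw [← hsub, ← hCF, partialEval_mul, partialEval, Finset.sum_mul]
      refine (Finset.sum_le_sum fun s hs => mul_le_mul_of_nonneg_left ?_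
        (mul_nonneg (hC _) (pow_nonneg hr _))).trans
        (Finset.sum_le_sum_of_subset_of_nonneg
          (Finset.range_subset_range.2 (by omega : n + 1 ≤ n + M + 1)) fun s _ _ =>
            mul_nonneg (mul_nonneg (hC _) (pow_nonneg hr _)) (partialEval_nonneg hr hF _))
      have := Finset.mem_range.1 hs
      exact partialEval_mono hr hF (by omega)
    have h2 : partialEval r n c * ℓ ≤ ℓ - 1 :=
      le_of_tendsto_of_tendsto' (hlim.const_mul _)
        ((hlim.comp (tendsto_add_atTop_nat n)).sub_const 1)
        fun M => by simpa [add_comm] using h1 M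
    have hℓ0 : 0 < ℓ := by linarith
    have h3 : partialEval r n c ≤ 1 - ℓ⁻¹ := by
      rw [← le_div_iff₀ hℓ0] at h2
      refine h2.trans_eq ?_
      field_simp
    have h4 : Ψ⁻¹ ≤ ℓ⁻¹ := inv_anti₀ hℓ0 hℓΨ
    linarith
  have hB : ∀ m, |coeff m F⁻¹| ≤ coeff m (1 + c) := by
    intro m
    have e : F⁻¹ = 1 - c := by rw [hc]; ring
    rw [e, map_sub, map_add]
    refine (abs_sub _ _).trans ?_
    rw [abs_of_nonneg (hC m), coeff_one]
    split_ifs <;> simp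
  have hBn : ∀ m, 0 ≤ coeff m (1 + c) := fun m => (abs_nonneg _).trans (hB m)
  have hBk : ∀ m, 0 ≤ coeff m ((1 + c) ^ n) := fun m =>
    (abs_nonneg _).trans (abs_coeff_pow_le hB n m)
  have hadd : partialEval r n (1 + c) = 1 + partialEval r n c := by
    simp only [partialEval, map_add, add_mul, Finset.sum_add_distrib]
    congr 1
    rw [Finset.sum_eq_single 0] <;> simp +contextual [coeff_one]
  calc |coeff n (F⁻¹ ^ n)| * r ^ n ≤ coeff n ((1 + c) ^ n) * r ^ n :=
        mul_le_mul_of_nonneg_right (abs_coeff_pow_le hB n n) (pow_nonneg hr _)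
    _ ≤ partialEval r n ((1 + c) ^ n) :=
        Finset.single_le_sum (f := fun m => coeff m ((1 + c) ^ n) * r ^ m)
          (fun m _ => mul_nonneg (hBk m) (pow_nonneg hr _)) (Finset.mem_range.2 (by omega))
    _ ≤ partialEval r n (1 + c) ^ n := partialEval_pow_le hr hBn n n
    _ ≤ (2 - Ψ⁻¹) ^ n := by
        refine pow_le_pow_left₀ (partialEval_nonneg hr hBn n) ?_ n
        rw [hadd]
        linarith

end FormalSeries

section Virial

lemma isRepulsive_pairW {d : ℕ} {β : ℝ} (hβ : 0 < β) {φ : (Fin d → ℝ) → ℝ≥0∞}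
    (hφm : Measurable φ) (hφeven : ∀ v, φ (-v) = φ v) : IsRepulsive (pairW β φ) where
  symm x y := by rw [pairW, pairW, ← neg_sub, hφeven]
  meas := by
    have h1 : Measurable fun q : (Fin d → ℝ) × (Fin d → ℝ) => φ (q.1 - q.2) :=
      hφm.comp (measurable_fst.sub measurable_snd)
    exact Measurable.ite (h1 (measurableSet_singleton ∞)) measurable_const
      (Real.measurable_exp.comp (h1.ennreal_toReal.const_mul β).neg)
  nonneg x y := by
    rw [pairW]
    split_ifs
    · exact le_rfl
    · exact (Real.exp_pos _).le
  le_one x y := by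
    rw [pairW]
    split_ifs
    · exact zero_le_one
    · exact Real.exp_le_one_iff.2 (neg_nonpos.2 (mul_nonneg hβ.le ENNReal.toReal_nonneg))
  trans v x y := by rw [pairW, pairW, add_sub_add_right_eq_sub]

lemma vertexInt_zero {d : ℕ} (w : (Fin d → ℝ) → (Fin d → ℝ) → ℝ) : vertexInt w 0 = 1 := by
  simp [vertexInt, phiVertex, volume_pi]

lemma vertexSum_eq_tsum {d : ℕ} (β : ℝ) (φ : (Fin d → ℝ) → ℝ≥0∞) (t : ℝ≥0∞) :
    vertexSum β φ t = ∑' n, vertexInt (pairW β φ) n / n.factorial * t ^ n := by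
  rw [tsum_eq_zero_add' ENNReal.summable, vertexInt_zero, vertexSum]
  congr 1
  · simp
  · refine tsum_congr fun n => ?_
    rw [ENNReal.div_eq_inv_mul, ENNReal.div_eq_inv_mul, gCoef, vertexInt]
    ring

section Coefficients

variable {d : ℕ} {β : ℝ} {φ : (Fin d → ℝ) → ℝ≥0∞} (hw : IsRepulsive (pairW β φ))
include hw

lemma bCoef_eq (n : ℕ) : bCoef β φ n = (-1) ^ n * (clusterInt (pairW β φ) n).toReal := by
  have hm : Measurable fun y : Fin n → Fin d → ℝ =>
      (-1) ^ n * omegaT (pairW β φ) (n + 1) (Fin.cons 0 y) := by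
    have : Measurable fun y : Fin n → Fin d → ℝ => (Fin.cons 0 y : Fin (n + 1) → Fin d → ℝ) :=
      measurable_pi_iff.2 fun i => by
        refine Fin.cases ?_ (fun j => ?_) i
        · exact measurable_const
        · exact measurable_pi_apply j
    exact ((measurable_omegaT hw).comp this).const_mul _
  rw [clusterInt, ← integral_eq_lintegral_of_nonneg_ae
    (Filter.Eventually.of_forall fun y => omegaT_sign_nonneg hw y 0) hm.aestronglyMeasurable,
    integral_const_mul, ← mul_assoc, ← mul_pow, bCoef]
  simp

lemma vCoef_eq (n : ℕ) : vCoef β φ n =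
    n.factorial * ((-1) ^ n * PowerSeries.coeff n ((clusterSeries (pairW β φ))⁻¹ ^ n)) := by
  rcases Nat.eq_zero_or_pos n with rfl | hn
  · simp [vCoef]
  have hb0 : bCoef β φ 0 = 1 := by rw [bCoef_eq hw, clusterInt_zero hw]; simp
  have hF0 : PowerSeries.constantCoeff (clusterSeries (pairW β φ)) ≠ 0 := by
    simp [clusterSeries, clusterInt_zero hw]
  have e1 : PowerSeries.mk (fun i => bCoef β φ i / i.factorial) =
      PowerSeries.rescale (-1) (clusterSeries (pairW β φ)) := by
    ext i
    rw [PowerSeries.coeff_rescale, clusterSeries, PowerSeries.coeff_mk, PowerSeries.coeff_mk,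
      bCoef_eq hw]
    ring
  have e2 : (PowerSeries.rescale (-1) (clusterSeries (pairW β φ)))⁻¹ =
      PowerSeries.rescale (-1) (clusterSeries (pairW β φ))⁻¹ := by
    symm
    rw [PowerSeries.eq_inv_iff_mul_eq_one, ← map_mul, PowerSeries.inv_mul_cancel _ hF0, map_one]
    rw [← PowerSeries.coeff_zero_eq_constantCoeff_apply, PowerSeries.coeff_rescale]
    simpa using hF0
  rw [vCoef, if_neg hn.ne', sum_genBinom_bellPoly _ hb0 hn.ne', e1, e2, ← map_pow,
    PowerSeries.coeff_rescale]

lemma abs_vCoef_le {μ : ℝ} (hμ : 0 < μ) (hΨ : vertexSum β φ (ENNReal.ofReal μ) ≠ ∞) (n : ℕ) :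
    |vCoef β φ n| ≤ n.factorial *
      ((2 * (vertexSum β φ (ENNReal.ofReal μ)).toReal - 1) / μ) ^ n := by
  set Ψ := vertexSum β φ (ENNReal.ofReal μ) with hΨdef
  have hΨ1 : 1 ≤ Ψ := by rw [hΨdef, vertexSum]; exact le_self_add
  have hΨ0 : Ψ ≠ 0 := (zero_lt_one.trans_le hΨ1).ne'
  have hμ0 : ENNReal.ofReal μ ≠ 0 := (ENNReal.ofReal_pos.2 hμ).ne'
  set r := ENNReal.ofReal μ / Ψ with hr
  have hr0 : r ≠ 0 := ENNReal.div_ne_zero.2 ⟨hμ0, hΨ⟩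
  have hrt : r ≠ ∞ := ENNReal.div_ne_top ENNReal.ofReal_ne_top hΨ0
  have hrΨ : r * Ψ = ENNReal.ofReal μ := ENNReal.div_mul_cancel hΨ0 hΨ
  have hrreal : r.toReal = μ / Ψ.toReal := by
    rw [hr, ENNReal.toReal_div, ENNReal.toReal_ofReal hμ.le]
  have hΨr : 0 < Ψ.toReal := ENNReal.toReal_pos hΨ0 hΨ
  have hsum := sum_clusterInt_le hw (r := r) (Ψ := Ψ)
    (by rw [hrΨ, hΨdef, vertexSum_eq_tsum])
  have hterm : ∀ n, clusterInt (pairW β φ) n / n.factorial * r ^ n ≠ ∞ := fun n =>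
    ne_top_of_le_ne_top hΨ ((Finset.single_le_sum (f := fun n =>
      clusterInt (pairW β φ) n / n.factorial * r ^ n) (fun _ _ => zero_le)
      (Finset.self_mem_range_succ n)).trans (hsum n))
  have hfin : ∀ n, clusterInt (pairW β φ) n ≠ ∞ := by
    intro n h
    refine hterm n ?_
    rw [h, ENNReal.top_div_of_ne_top (ENNReal.natCast_ne_top _),
      ENNReal.top_mul (pow_ne_zero _ hr0)]
  have hpart : ∀ N, partialEval r.toReal N (clusterSeries (pairW β φ)) ≤ Ψ.toReal := by
    intro N
    have := ENNReal.toReal_mono hΨ (hsum N)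
    rw [ENNReal.toReal_sum fun n _ => hterm n] at this
    refine le_trans (le_of_eq ?_) this
    refine Finset.sum_congr rfl fun n _ => ?_
    rw [clusterSeries, PowerSeries.coeff_mk, ENNReal.toReal_mul,
      ENNReal.toReal_div (clusterInt _ _), ENNReal.toReal_natCast, ENNReal.toReal_pow]
  have key := abs_coeff_inv_pow_le (F := clusterSeries (pairW β φ))
    (fun n => by
      rw [clusterSeries, PowerSeries.coeff_mk]
      positivity)
    (by simp [clusterSeries, clusterInt_zero hw])
    (coeff_one_sub_inv_clusterSeries_nonneg hw hfin) ENNReal.toReal_nonneg hpart n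
  rw [vCoef_eq hw, abs_mul, Nat.abs_cast, abs_mul, abs_pow, abs_neg, abs_one, one_pow, one_mul]
  refine mul_le_mul_of_nonneg_left ?_ (Nat.cast_nonneg _)
  rw [hrreal, ← le_div_iff₀ (by positivity), ← div_pow] at key
  refine key.trans_eq ?_
  congr 1
  field_simp

lemma summable_virial {μ : ℝ} (hμ : 0 < μ) (hΨ : vertexSum β φ (ENNReal.ofReal μ) ≠ ∞) {z : ℂ}
    (hz : ‖z‖ * (2 * (vertexSum β φ (ENNReal.ofReal μ)).toReal - 1) < μ) :
    Summable fun n : ℕ => (vCoef β φ n : ℂ) / ((n + 1).factorial : ℂ) * z ^ (n + 1) := by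
  set K := 2 * (vertexSum β φ (ENNReal.ofReal μ)).toReal - 1 with hK
  have hΨ1 : 1 ≤ (vertexSum β φ (ENNReal.ofReal μ)).toReal := by
    rw [← ENNReal.toReal_one]
    exact ENNReal.toReal_mono hΨ (by rw [vertexSum]; exact le_self_add)
  have hK1 : 0 ≤ K := by rw [hK]; linarith
  have hq0 : 0 ≤ ‖z‖ * K / μ := by positivity
  have hq1 : ‖z‖ * K / μ < 1 := (div_lt_one hμ).2 hz
  refine Summable.of_norm_bounded ((summable_geometric_of_lt_one hq0 hq1).mul_left ‖z‖) fun n => ?_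
  rw [norm_mul, norm_div, norm_pow, Complex.norm_real, Complex.norm_natCast, Real.norm_eq_abs]
  have hf : (0 : ℝ) < (n + 1).factorial := by exact_mod_cast (n + 1).factorial_pos
  have h1 : |vCoef β φ n| / (n + 1).factorial ≤ (K / μ) ^ n := by
    rw [div_le_iff₀ hf]
    refine (abs_vCoef_le hw hμ hΨ n).trans ?_
    rw [mul_comm]
    refine mul_le_mul_of_nonneg_left ?_ (by positivity)
    exact_mod_cast Nat.factorial_le (Nat.le_succ n)
  calc _ ≤ (K / μ) ^ n * ‖z‖ ^ (n + 1) := mul_le_mul_of_nonneg_right h1 (by positivity)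
    _ = ‖z‖ * (‖z‖ * K / μ) ^ n := by
      rw [mul_div_assoc, mul_pow, pow_succ]; ring

lemma summable_virial_of_lt_iSup {s : ℝ} {z : ℂ}
    (hz : ENNReal.ofReal ‖z‖ < ⨆ (μ : ℝ) (_ : 0 < μ ∧ μ ≤ s),
      ENNReal.ofReal μ / (2 * vertexSum β φ (ENNReal.ofReal μ) - 1)) :
    Summable fun n : ℕ => (vCoef β φ n : ℂ) / ((n + 1).factorial : ℂ) * z ^ (n + 1) := by
  obtain ⟨μ, hz⟩ := lt_iSup_iff.1 hz
  obtain ⟨⟨hμ, -⟩, hz⟩ := lt_iSup_iff.1 hz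
  have hΨ : vertexSum β φ (ENNReal.ofReal μ) ≠ ∞ := by
    intro h
    rw [h] at hz
    simp at hz
  have hΨ1 : 1 ≤ vertexSum β φ (ENNReal.ofReal μ) := by rw [vertexSum]; exact le_self_add
  refine summable_virial hw hμ hΨ ?_
  generalize vertexSum β φ (ENNReal.ofReal μ) = Ψ at *
  lift Ψ to NNReal using hΨ
  have hΨ1 : (1 : ℝ) ≤ Ψ := by exact_mod_cast hΨ1
  have hK : (2 * (Ψ : ℝ≥0∞) - 1) = ENNReal.ofReal (2 * (Ψ : ℝ) - 1) := by
    rw [ENNReal.ofReal_sub _ zero_le_one, ENNReal.ofReal_mul zero_le_two]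
    simp
  have hK0 : 0 < 2 * (Ψ : ℝ) - 1 := by linarith
  rw [hK, ← ENNReal.ofReal_div_of_pos hK0, ENNReal.ofReal_lt_ofReal_iff (by positivity),
    lt_div_iff₀ hK0] at hz
  simpa using hz

end Coefficients

end Virial

section Maximum

lemma vertexInt_ne_top {d : ℕ} {w : (Fin d → ℝ) → (Fin d → ℝ) → ℝ} (hw : IsRepulsive w)
    (hT : ∫⁻ v : Fin d → ℝ, ENNReal.ofReal (1 - w v 0) < ∞) (n : ℕ) : vertexInt w n ≠ ∞ := by
  have h0 : ∀ v, 0 ≤ 1 - w 0 v := fun v => sub_nonneg.2 (hw.le_one 0 v)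
  have hfi : Integrable (fun v => 1 - w 0 v) volume := by
    refine ⟨((measurable_const.sub
      (hw.meas.comp measurable_prodMk_left))).aestronglyMeasurable, ?_⟩
    rw [hasFiniteIntegral_iff_ofReal (Filter.Eventually.of_forall h0)]
    simpa only [hw.symm 0] using hT
  have hprod : Integrable (fun y : Fin n → Fin d → ℝ => ∏ i, (1 - w 0 (y i))) volume :=
    Integrable.fintype_prod fun _ => hfi
  refine ne_top_of_le_ne_top ((hasFiniteIntegral_iff_ofReal (Filter.Eventually.of_forall
    fun y => Finset.prod_nonneg fun i _ => h0 (y i))).1 hprod.2).ne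
    (lintegral_mono fun y => ENNReal.ofReal_le_ofReal ?_)
  exact mul_le_of_le_one_right (Finset.prod_nonneg fun i _ => h0 (y i))
    (Finset.prod_le_one (fun p _ => hw.nonneg _ _) fun p _ => hw.le_one _ _)

/-- The quotient of the identity by a power series with nonnegative coefficients attains its
maximum on the positive half-line as soon as the series grows at least quadratically. -/
lemma exists_forall_div_powerSeries_le {c : ℕ → ℝ≥0∞} (h0 : c 0 = 1) (hc : ∀ n, c n ≠ ∞)
    (h2 : c 2 ≠ 0) :
    ∃ s : ℝ, 0 < s ∧ ∀ t : ℝ, 0 < t →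
      ENNReal.ofReal t / (∑' n, c n * ENNReal.ofReal t ^ n) ≤
        ENNReal.ofReal s / (∑' n, c n * ENNReal.ofReal s ^ n) := by
  set f : ℝ → ℝ≥0∞ := fun t => ENNReal.ofReal t / (∑' n, c n * ENNReal.ofReal t ^ n) with hf
  have husc : UpperSemicontinuous f := by
    have : f = fun t => ⨅ N : ℕ, ENNReal.ofReal t *
        (∑ n ∈ Finset.range (N + 1), c n * ENNReal.ofReal t ^ n)⁻¹ := by
      funext t
      simp only [hf]
      rw [ENNReal.tsum_eq_iSup_nat' (Filter.tendsto_add_atTop_nat 1), div_eq_mul_inv,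
        ENNReal.inv_iSup, ENNReal.mul_iInf fun h => absurd h ENNReal.ofReal_ne_top]
    rw [this]
    refine upperSemicontinuous_iInf fun N => Continuous.upperSemicontinuous ?_
    refine continuous_iff_continuousAt.2 fun t => ?_
    refine ENNReal.Tendsto.mul ENNReal.continuous_ofReal.continuousAt (Or.inr ?_) ?_
      (Or.inr ENNReal.ofReal_ne_top)
    · rw [ENNReal.inv_ne_top, Finset.sum_range_succ', h0]
      simp
    · refine tendsto_inv_iff.2 (Continuous.continuousAt ?_)
      exact continuous_finsetSum _ fun n _ =>
        (ENNReal.continuous_const_mul (hc n)).comp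
          ((ENNReal.continuous_pow n).comp ENNReal.continuous_ofReal)
  by_cases hz : ∀ t, 0 < t → f t = 0
  · exact ⟨1, one_pos, fun t ht => (hz t ht).le.trans zero_le⟩
  push Not at hz
  obtain ⟨t₀, ht₀, hft₀⟩ := hz
  have hbt : ((f t₀)⁻¹ / c 2) ≠ ∞ := ENNReal.div_ne_top (ENNReal.inv_ne_top.2 hft₀) h2
  have hftop : f t₀ ≠ ∞ := by
    refine ENNReal.div_ne_top ENNReal.ofReal_ne_top fun h => ?_
    simpa [h0] using ENNReal.tsum_eq_zero.1 h 0
  set b : ℝ := max t₀ ((f t₀)⁻¹ / c 2).toReal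
  obtain ⟨s, hs, hmax⟩ := (husc.upperSemicontinuousOn (Set.Icc 0 b)).exists_isMaxOn
    (Set.nonempty_Icc.2 (ht₀.le.trans (le_max_left _ _))) isCompact_Icc
  have h1 : f t₀ ≤ f s := hmax ⟨ht₀.le, le_max_left _ _⟩
  refine ⟨s, lt_of_le_of_ne hs.1 ?_, fun t ht => ?_⟩
  · rintro rfl
    exact hft₀ (le_antisymm (h1.trans (by simp [hf])) zero_le)
  rcases le_total t b with htb | htb
  · exact hmax ⟨ht.le, htb⟩
  refine le_trans ?_ h1
  have ht0 : ENNReal.ofReal t ≠ 0 := by simpa using ht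
  have h3 : c 2 * ENNReal.ofReal t ^ 2 ≤ ∑' n, c n * ENNReal.ofReal t ^ n :=
    ENNReal.le_tsum (f := fun n => c n * ENNReal.ofReal t ^ n) 2
  have h4 : (f t₀)⁻¹ ≤ c 2 * ENNReal.ofReal t := by
    rw [mul_comm, ← ENNReal.div_le_iff h2 (hc 2), ENNReal.le_ofReal_iff_toReal_le hbt ht.le]
    exact (le_max_right _ _).trans htb
  refine ENNReal.div_le_of_le_mul ?_
  calc ENNReal.ofReal t = f t₀ * (f t₀)⁻¹ * ENNReal.ofReal t := by
        rw [ENNReal.mul_inv_cancel hft₀ hftop, one_mul]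
    _ ≤ f t₀ * (c 2 * ENNReal.ofReal t) * ENNReal.ofReal t := by gcongr
    _ = f t₀ * (c 2 * ENNReal.ofReal t ^ 2) := by ring
    _ ≤ _ := by gcongr

end Maximum

section Positivity

/-- A set of finite measure that is invariant under a nonzero translation is null. -/
lemma measure_eq_zero_of_translate_ae_eq {d : ℕ} {A : Set (Fin d → ℝ)} (hA : MeasurableSet A)
    (hfin : volume A ≠ ∞) {x : Fin d → ℝ} {i : Fin d} (hx : x i ≠ 0)
    (hinv : A =ᵐ[volume] {y | y - x ∈ A}) : volume A = 0 := by
  have hm : Continuous fun y : Fin d → ℝ => Real.arctan (x i * y i) :=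
    Real.continuous_arctan.comp (continuous_const.mul (continuous_apply i))
  have hfi : ∀ v : Fin d → ℝ, IntegrableOn (fun y => Real.arctan (x i * (y + v) i)) A := by
    intro v
    refine Measure.integrableOn_of_bounded hfin
      (hm.comp (continuous_id.add continuous_const)).aestronglyMeasurable (M := Real.pi / 2)
      (Filter.Eventually.of_forall fun y => ?_)
    exact (abs_lt.2 ⟨Real.neg_pi_div_two_lt_arctan _, Real.arctan_lt_pi_div_two _⟩).le
  have h0 := hfi 0
  simp only [add_zero] at h0
  have heq : ∫ y in A, Real.arctan (x i * y i) = ∫ y in A, Real.arctan (x i * (y + x) i) := by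
    rw [setIntegral_congr_set hinv, ← integral_indicator hA,
      ← integral_indicator (s := {y | y - x ∈ A}) (hA.preimage (measurable_id.sub_const x)),
      ← integral_add_right_eq_self _ x]
    congr 1 with y
    simp [Set.indicator_apply]
  have hlt : ∀ y : Fin d → ℝ, Real.arctan (x i * y i) < Real.arctan (x i * (y + x) i) := fun y =>
    Real.arctan_strictMono (by rw [Pi.add_apply, mul_add]; linarith [mul_self_pos.2 hx])
  by_contra hne
  have hpos := (setIntegral_pos_iff_support_of_nonneg_ae (μ := volume) (s := A)
    (Filter.Eventually.of_forall fun y => (sub_pos.2 (hlt y)).le) ((hfi x).sub h0)).2 (by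
      rw [Function.support_eq_univ fun y => (sub_pos.2 (hlt y)).ne', Set.univ_inter]
      exact pos_iff_ne_zero.2 hne)
  rw [integral_sub (hfi x) h0, heq, sub_self] at hpos
  exact hpos.false

/-- The integrand of `vertexInt_two` is measurable. -/
lemma measurable_phiVertex_two {d : ℕ} {w : (Fin d → ℝ) → (Fin d → ℝ) → ℝ} (hw : IsRepulsive w) :
    Measurable fun p : (Fin d → ℝ) × (Fin d → ℝ) =>
      ENNReal.ofReal ((1 - w 0 p.1) * (1 - w 0 p.2) * w p.1 p.2) := by
  have h0 : Measurable (w 0) := hw.meas.comp measurable_prodMk_left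
  exact ((((h0.comp measurable_fst).const_sub 1).mul ((h0.comp measurable_snd).const_sub 1)).mul
    hw.meas).ennreal_ofReal

lemma vertexInt_two {d : ℕ} {w : (Fin d → ℝ) → (Fin d → ℝ) → ℝ} (hw : IsRepulsive w) :
    vertexInt w 2 = ∫⁻ p : (Fin d → ℝ) × (Fin d → ℝ),
      ENNReal.ofReal ((1 - w 0 p.1) * (1 - w 0 p.2) * w p.1 p.2) := by
  rw [← (volume_preserving_finTwoArrow (Fin d → ℝ)).lintegral_comp (measurable_phiVertex_two hw)]
  have hs : Finset.univ.filter (fun p : Fin 2 × Fin 2 => p.1 < p.2) = {(0, 1)} := by decide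
  simp only [vertexInt, phiVertex, hs, Finset.prod_singleton, Fin.prod_univ_two]
  rfl

lemma vertexInt_two_ne_zero {d : ℕ} (hd : 1 ≤ d) {β : ℝ} (hβ : 0 < β)
    {φ : (Fin d → ℝ) → ℝ≥0∞} (hφm : Measurable φ) (hφeven : ∀ v, φ (-v) = φ v)
    (hT : ∫⁻ v : Fin d → ℝ, ENNReal.ofReal (1 - pairW β φ v 0) < ∞)
    (hφ0 : ¬ φ =ᵐ[volume] (fun _ => 0)) : vertexInt (pairW β φ) 2 ≠ 0 := by
  intro h
  have hw := isRepulsive_pairW hβ hφm hφeven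
  have hlt : ∀ v, φ v ≠ 0 → 0 < 1 - pairW β φ 0 v := by
    intro v hv
    rw [pairW, zero_sub, hφeven, sub_pos]
    split_ifs with hi
    · exact one_pos
    · exact Real.exp_lt_one_iff.2 (neg_lt_zero.2 (mul_pos hβ (ENNReal.toReal_pos hv hi)))
  rw [vertexInt_two hw, lintegral_eq_zero_iff (measurable_phiVertex_two hw)] at h
  set A : Set (Fin d → ℝ) := {v | φ v ≠ 0}
  set H : Set (Fin d → ℝ) := {v | φ v = ∞}
  have hA : MeasurableSet A := (hφm (measurableSet_singleton 0)).compl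
  have hH : MeasurableSet H := hφm (measurableSet_singleton ∞)
  have hA0 : volume A ≠ 0 := fun hz => hφ0 (ae_iff.2 hz)
  have hHfin : volume H ≠ ∞ := by
    refine ne_top_of_le_ne_top hT.ne ?_
    rw [← lintegral_indicator_one hH]
    refine lintegral_mono fun v => ?_
    refine Set.indicator_apply_le' (fun hv => ?_) fun _ => zero_le
    have : φ v = ∞ := hv
    simp [pairW, this]
  have hae : ∀ᵐ x : Fin d → ℝ, ∀ᵐ y : Fin d → ℝ, x ∈ A → y ∈ A → x - y ∈ H := by
    refine Measure.ae_ae_of_ae_prod (p := fun q : (Fin d → ℝ) × (Fin d → ℝ) =>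
      q.1 ∈ A → q.2 ∈ A → q.1 - q.2 ∈ H) ?_
    filter_upwards [h] with q hq h1 h2
    by_contra hH'
    have hp : 0 < pairW β φ q.1 q.2 := by
      rw [pairW, if_neg (show ¬ φ (q.1 - q.2) = ∞ from hH')]
      exact Real.exp_pos _
    exact (ENNReal.ofReal_pos.2 (mul_pos (mul_pos (hlt _ h1) (hlt _ h2)) hp)).ne' hq
  obtain ⟨x, hxA, hxae, hxi⟩ : ∃ x ∈ A, (∀ᵐ y : Fin d → ℝ, x ∈ A → y ∈ A → x - y ∈ H) ∧
      x ⟨0, hd⟩ ≠ 0 := by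
    have hfr : ∃ᵐ x : Fin d → ℝ, x ∈ A := frequently_ae_mem_iff.2 hA0
    exact (hfr.and_eventually (hae.and (Measure.ae_eval_ne (fun _ => volume) ⟨0, hd⟩ 0))).exists
  have hsub : A ≤ᵐ[volume] {y | x - y ∈ H} := by
    filter_upwards [hxae] with y hy hyA using hy hxA hyA
  have hAfin : volume A ≠ ∞ := by
    refine ne_top_of_le_ne_top ?_ (measure_mono_ae hsub)
    have := (Measure.measurePreserving_sub_left volume x).measure_preimage hH.nullMeasurableSet
    exact this.trans_ne hHfin
  have hsub' : A ≤ᵐ[volume] {y | y - x ∈ A} := by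
    filter_upwards [hsub] with y hy hyA
    have h1 : φ (x - y) = ∞ := hy hyA
    change φ (y - x) ≠ 0
    rw [← neg_sub, hφeven, h1]
    exact ENNReal.top_ne_zero
  refine hA0 (measure_eq_zero_of_translate_ae_eq hA hAfin hxi ?_)
  refine ae_eq_of_ae_subset_of_measure_ge hsub' ?_ hA.nullMeasurableSet ?_
  · exact ((measurePreserving_sub_right volume x).measure_preimage hA.nullMeasurableSet).le
  · exact ((measurePreserving_sub_right volume x).measure_preimage hA.nullMeasurableSet).trans_ne
      hAfin

end Positivity

/-- the efficient virial convergence criterion. -/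
theorem statement16 {d : ℕ} (hd : 1 ≤ d) (β : ℝ) (hβ : 0 < β)
    (φ : (Fin d → ℝ) → ℝ≥0∞) (hφm : Measurable φ) (hφeven : ∀ v, φ (-v) = φ v)
    (hT : ∫⁻ v : Fin d → ℝ, ENNReal.ofReal (1 - pairW β φ v 0) < ∞)
    (hφ0 : ¬ φ =ᵐ[volume] (fun _ => 0)) :
    (∃ μstar : ℝ, 0 < μstar ∧
      ∀ μ : ℝ, 0 < μ →
        ENNReal.ofReal μ / vertexSum β φ (ENNReal.ofReal μ)
          ≤ ENNReal.ofReal μstar / vertexSum β φ (ENNReal.ofReal μstar)) ∧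
    ∀ μstar : ℝ, 0 < μstar →
      (∀ μ : ℝ, 0 < μ →
        ENNReal.ofReal μ / vertexSum β φ (ENNReal.ofReal μ)
          ≤ ENNReal.ofReal μstar / vertexSum β φ (ENNReal.ofReal μstar)) →
      ∀ z : ℂ, ENNReal.ofReal ‖z‖ <
          (⨆ (μ : ℝ) (_ : 0 < μ ∧ μ ≤ μstar),
            ENNReal.ofReal μ / (2 * vertexSum β φ (ENNReal.ofReal μ) - 1)) →
        Summable (fun n : ℕ => (vCoef β φ n : ℂ) / ((n + 1).factorial : ℂ) * z ^ (n + 1)) := by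
  have hw := isRepulsive_pairW hβ hφm hφeven
  refine ⟨?_, fun μstar _ _ z hz => summable_virial_of_lt_iSup hw hz⟩
  simp only [vertexSum_eq_tsum]
  refine exists_forall_div_powerSeries_le (by simp [vertexInt_zero]) (fun n =>
    ENNReal.div_ne_top (vertexInt_ne_top hw hT n) (by simp [Nat.factorial_ne_zero])) ?_
  exact ENNReal.div_ne_zero.2 ⟨vertexInt_two_ne_zero hd hβ hφm hφeven hT hφ0, by simp⟩
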